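/- arXiv:1606.06157 — 4 statements merged into one kernel-verified Lean document; each statement's English description precedes it below -/
import Mathlib

section
/- Let α ∈ (0,1], let η, E > 0, set τ = η/E, and let σ: [0,1] → ℝ be continuous. Define ε(t) = (1/η^α) ∫₀ᵗ (t−s)^{α−1} E_{α,α}(−((t−s)/τ)^α) σ(s) ds for t ∈ [0,1]. Then ε(0) = 0 and ε satisfies the Volterra integral equation of the second kind ε(t) = (1/(η^α Γ(α))) ∫₀ᵗ (t−s)^{α−1} σ(s) ds − (1/(τ^α Γ(α))) ∫₀ᵗ (t−s)^{α−1} ε(s) ds for every t ∈ [0,1]. -/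
/-- The generalized Mittag-Leffler function `E_{a,b}(t) = ∑_{n=0}^∞ tⁿ/Γ(a n + b)`. -/
noncomputable def mittagLeffler (a b t : ℝ) : ℝ := ∑' n : ℕ, t ^ n / Real.Gamma (a * n + b)

open MeasureTheory Set in
theorem exp_neg_mul_rpow_le_Gamma {z R : ℝ} (hz : 1 ≤ z) (hR : 0 < R) :
    Real.exp (-R) * R ^ (z - 1) ≤ Real.Gamma z := by
  have hint := Real.GammaIntegral_convergent (by linarith : 0 < z)
  calc Real.exp (-R) * R ^ (z - 1) = ∫ x in Ioi R, Real.exp (-x) * R ^ (z - 1) := by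
        rw [integral_mul_const, integral_exp_neg_Ioi]
    _ ≤ ∫ x in Ioi R, Real.exp (-x) * x ^ (z - 1) := by
        refine setIntegral_mono_on ((integrableOn_exp_neg_Ioi R).mul_const _)
          (hint.mono_set (Ioi_subset_Ioi hR.le)) measurableSet_Ioi fun x hx => ?_
        have : R ≤ x := le_of_lt hx
        gcongr
    _ ≤ ∫ x in Ioi 0, Real.exp (-x) * x ^ (z - 1) := by
        refine setIntegral_mono_set hint ?_ (Ioi_subset_Ioi hR.le).eventuallyLE
        filter_upwards [ae_restrict_mem measurableSet_Ioi] with x hx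
        have : (0 : ℝ) < x := hx
        simp only [Pi.zero_apply]
        positivity
    _ = Real.Gamma z := (Real.Gamma_eq_integral (by linarith)).symm

theorem summable_pow_div_Gamma {a b : ℝ} (ha : 0 < a) (hb : 0 < b) (y : ℝ) :
    Summable fun n : ℕ => y ^ n / Real.Gamma (a * n + b) := by
  set r : ℝ := 2 * (|y| + 1)
  have hr : 0 < r := by positivity
  set R : ℝ := r ^ (1 / a)
  have hR : 0 < R := by positivity
  have hRa (n : ℕ) : R ^ (a * n) = r ^ n := by
    rw [← Real.rpow_mul hr.le, ← Real.rpow_natCast]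
    congr 1
    field_simp
  have hgeom : Summable fun n : ℕ => (1 / 2 : ℝ) ^ n * (Real.exp R * R ^ (1 - b)) :=
    (summable_geometric_of_lt_one (by norm_num) (by norm_num)).mul_right _
  refine hgeom.of_norm_bounded_eventually_nat ?_
  have hlarge : ∀ᶠ n : ℕ in Filter.atTop, 1 / a ≤ n :=
    tendsto_natCast_atTop_atTop.eventually_ge_atTop _
  filter_upwards [hlarge] with n hn
  have hz : 1 ≤ a * n + b := by
    have := (div_le_iff₀' ha).1 hn
    linarith
  have hG := exp_neg_mul_rpow_le_Gamma hz hR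
  have hpos : 0 < Real.exp (-R) * R ^ (a * n + b - 1) := by positivity
  have hexp : R ^ (a * n + b - 1) = r ^ n * (R ^ (1 - b))⁻¹ := by
    rw [← hRa, ← Real.rpow_neg hR.le, ← Real.rpow_add hR]
    congr 1
    ring
  rw [norm_div, norm_pow, Real.norm_eq_abs, Real.norm_of_nonneg (hpos.le.trans hG)]
  calc |y| ^ n / Real.Gamma (a * n + b)
      ≤ |y| ^ n / (Real.exp (-R) * R ^ (a * n + b - 1)) := by gcongr
    _ = (|y| / r) ^ n * (Real.exp R * R ^ (1 - b)) := by
        rw [hexp, Real.exp_neg, div_pow]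
        field_simp
    _ ≤ _ := by
        have : |y| / r ≤ 1 / 2 := by
          rw [div_le_div_iff₀ hr two_pos]
          linarith [abs_nonneg y]
        gcongr

theorem continuous_mittagLeffler {a b : ℝ} (ha : 0 < a) (hb : 0 < b) :
    Continuous (mittagLeffler a b) := by
  refine continuous_iff_continuousAt.2 fun x => ?_
  refine ContinuousOn.continuousAt (s := Metric.ball 0 (|x| + 1)) ?_
    (Metric.isOpen_ball.mem_nhds (by simp))
  refine continuousOn_tsum (fun n => by fun_prop) (summable_pow_div_Gamma ha hb (|x| + 1)) ?_
  intro n y hy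
  have hG : 0 < Real.Gamma (a * n + b) := Real.Gamma_pos_of_pos (by positivity)
  rw [norm_div, norm_pow, Real.norm_of_nonneg hG.le]
  gcongr
  simpa using (mem_ball_zero_iff.1 hy).le

theorem integral_sub_rpow_mul_rpow {a b x : ℝ} (ha : 0 < a) (hb : 0 < b) (hx : 0 < x) :
    ∫ s in (0 : ℝ)..x, (x - s) ^ (a - 1) * s ^ (b - 1) =
      Real.Gamma a * Real.Gamma b / Real.Gamma (a + b) * x ^ (a + b - 1) := by
  have h := Complex.betaIntegral_scaled (b : ℂ) (a : ℂ) hx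
  rw [Complex.betaIntegral_eq_Gamma_mul_div _ _ (by simpa) (by simpa)] at h
  apply Complex.ofReal_injective
  rw [← intervalIntegral.integral_ofReal]
  calc _ = ∫ s in (0 : ℝ)..x, (s : ℂ) ^ ((b : ℂ) - 1) * ((x : ℂ) - s) ^ ((a : ℂ) - 1) := by
        refine intervalIntegral.integral_congr fun s hs => ?_
        rw [Set.uIcc_of_le hx.le] at hs
        rw [Complex.ofReal_mul, Complex.ofReal_cpow (sub_nonneg.2 hs.2),
          Complex.ofReal_cpow hs.1, mul_comm]
        push_cast
        rfl
    _ = _ := by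
        rw [h, ← Complex.ofReal_add, Complex.Gamma_ofReal, Complex.Gamma_ofReal,
          Complex.Gamma_ofReal]
        rw [add_comm b a, Complex.ofReal_mul, Complex.ofReal_cpow hx.le]
        push_cast
        ring

theorem intervalIntegrable_sub_rpow_mul_rpow {a b x : ℝ} (ha : 0 < a) (hb : 0 < b) (hx : 0 < x) :
    IntervalIntegrable (fun s => (x - s) ^ (a - 1) * s ^ (b - 1)) MeasureTheory.volume 0 x := by
  by_contra h
  have h0 := integral_sub_rpow_mul_rpow ha hb hx
  rw [intervalIntegral.integral_undef h] at h0
  have hG {c : ℝ} (hc : 0 < c) : 0 < Real.Gamma c := Real.Gamma_pos_of_pos hc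
  have := hG ha
  have := hG hb
  have := hG (add_pos ha hb)
  exact absurd h0 (by positivity)

/-- The kernel `x^{α-1} E_{α,α}(-c x^α)` of the Volterra equation, expanded as a power series. -/
theorem rpow_mul_mittagLeffler {α c x : ℝ} (hx : 0 < x) :
    x ^ (α - 1) * mittagLeffler α α (-(c * x ^ α)) =
      ∑' n : ℕ, (-c) ^ n / Real.Gamma (α * n + α) * x ^ (α * n + α - 1) := by
  rw [mittagLeffler, ← tsum_mul_left]
  refine tsum_congr fun n => ?_
  rw [show α * n + α - 1 = (α - 1) + α * n by ring, Real.rpow_add hx, Real.rpow_mul hx.le,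
    Real.rpow_natCast, ← neg_mul, mul_pow]
  ring

open MeasureTheory in
theorem rpow_mul_mittagLeffler_eq_sub {α c x : ℝ} (hα : 0 < α) (hx : 0 < x) :
    x ^ (α - 1) * mittagLeffler α α (-(c * x ^ α)) =
      (1 / Real.Gamma α) * x ^ (α - 1) - (c / Real.Gamma α) *
        ∫ s in (0 : ℝ)..x, (x - s) ^ (α - 1) *
          (s ^ (α - 1) * mittagLeffler α α (-(c * s ^ α))) := by
  have hGα : 0 < Real.Gamma α := Real.Gamma_pos_of_pos hα
  have hβ (n : ℕ) : 0 < α * n + α := by positivity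
  have hG (n : ℕ) : 0 < Real.Gamma (α * n + α) := Real.Gamma_pos_of_pos (hβ n)
  set F : ℕ → ℝ → ℝ := fun n s =>
    (-c) ^ n / Real.Gamma (α * n + α) * ((x - s) ^ (α - 1) * s ^ (α * n + α - 1)) with hF
  have hFint (n : ℕ) : Integrable (F n) (volume.restrict (Set.Ioc 0 x)) :=
    ((intervalIntegrable_iff_integrableOn_Ioc_of_le hx.le).1
      (intervalIntegrable_sub_rpow_mul_rpow hα (hβ n) hx)).const_mul _
  have hval (d : ℝ) (n : ℕ) : ∫ s in Set.Ioc 0 x,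
      d ^ n / Real.Gamma (α * n + α) * ((x - s) ^ (α - 1) * s ^ (α * n + α - 1)) =
        Real.Gamma α * x ^ (2 * α - 1) *
          ((d * x ^ α) ^ n / Real.Gamma (α * n + 2 * α)) := by
    rw [integral_const_mul, ← intervalIntegral.integral_of_le hx.le,
      integral_sub_rpow_mul_rpow hα (hβ n) hx,
      show α + (α * n + α) - 1 = (2 * α - 1) + α * n by ring, Real.rpow_add hx,
      Real.rpow_mul hx.le, Real.rpow_natCast, mul_pow,
      show α + (α * n + α) = α * n + 2 * α by ring]
    have := (hG n).ne'
    field_simp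
  have hFnorm (n : ℕ) : ∫ s in Set.Ioc 0 x, ‖F n s‖ = Real.Gamma α * x ^ (2 * α - 1) *
      ((|c| * x ^ α) ^ n / Real.Gamma (α * n + 2 * α)) := by
    rw [← hval]
    refine setIntegral_congr_fun measurableSet_Ioc fun s hs => ?_
    have h1 : 0 ≤ (x - s) ^ (α - 1) * s ^ (α * n + α - 1) :=
      mul_nonneg (Real.rpow_nonneg (sub_nonneg.2 hs.2) _) (Real.rpow_nonneg hs.1.le _)
    simp only [hF]
    rw [norm_mul, norm_div, norm_pow, norm_neg, Real.norm_of_nonneg h1,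
      Real.norm_of_nonneg (hG n).le, Real.norm_eq_abs]
  have hsum := hasSum_integral_of_summable_integral_norm hFint (by
    simp_rw [hFnorm]
    exact (summable_pow_div_Gamma hα (by positivity) _).mul_left _)
  have hI : ∫ s in (0 : ℝ)..x, (x - s) ^ (α - 1) *
      (s ^ (α - 1) * mittagLeffler α α (-(c * s ^ α))) = ∫ s in Set.Ioc 0 x, ∑' n, F n s := by
    rw [intervalIntegral.integral_of_le hx.le]
    refine setIntegral_congr_fun measurableSet_Ioc fun s hs => ?_
    rw [rpow_mul_mittagLeffler hs.1, ← tsum_mul_left]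
    exact tsum_congr fun n => by simp only [hF]; ring
  rw [hI, ← hsum.tsum_eq, mittagLeffler,
    (summable_pow_div_Gamma hα hα _).tsum_eq_zero_add, mul_add,
    sub_eq_add_neg _ (_ * _), ← tsum_mul_left, ← tsum_mul_left, ← tsum_neg]
  congr 1
  · simp [mul_comm]
  · refine tsum_congr fun n => ?_
    rw [hval, show α * ((n + 1 : ℕ) : ℝ) + α = α * n + 2 * α by push_cast; ring,
      show 2 * α - 1 = (α - 1) + α by ring, Real.rpow_add hx]
    have := hGα.ne'
    field_simp
    ring

open MeasureTheory Set ContinuousLinearMap in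
theorem convolution_indicator_eq_intervalIntegral {f g : ℝ → ℝ} {t x : ℝ} (hx : 0 ≤ x)
    (hxt : x ≤ t) :
    convolution ((Icc 0 t).indicator f) ((Icc 0 t).indicator g) (mul ℝ ℝ) volume x =
      ∫ s in (0 : ℝ)..x, f (x - s) * g s := by
  rw [convolution_eq_swap, intervalIntegral.integral_of_le hx, ← integral_Icc_eq_integral_Ioc,
    ← integral_indicator measurableSet_Icc]
  congr 1 with s
  simp only [indicator_apply, mem_Icc, mul_apply']
  split_ifs <;> grind

open MeasureTheory Set ContinuousLinearMap in
theorem convolution_indicator_eq_zero_of_neg {f g : ℝ → ℝ} {t x : ℝ} (hx : x < 0) :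
    convolution ((Icc 0 t).indicator f) ((Icc 0 t).indicator g) (mul ℝ ℝ) volume x = 0 := by
  rw [convolution_eq_swap]
  refine integral_eq_zero_of_ae (Filter.Eventually.of_forall fun s => ?_)
  simp only [indicator_apply, mem_Icc, mul_apply', Pi.zero_apply]
  split_ifs <;> grind

open MeasureTheory Set ContinuousLinearMap in
/-- Associativity of the convolution of Volterra type on `[0, t]`. -/
theorem intervalIntegral_volterra_assoc {f g k : ℝ → ℝ} {t : ℝ} (ht : 0 ≤ t)
    (hf : IntervalIntegrable f volume 0 t) (hg : IntervalIntegrable g volume 0 t)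
    (hk : ContinuousOn k (Icc 0 t)) :
    ∫ s in (0 : ℝ)..t, f (t - s) * ∫ u in (0 : ℝ)..s, g (s - u) * k u =
      ∫ s in (0 : ℝ)..t, (∫ u in (0 : ℝ)..(t - s), f (t - s - u) * g u) * k s := by
  have hind {h : ℝ → ℝ} (hh : IntervalIntegrable h volume 0 t) :
      Integrable ((Icc 0 t).indicator h) :=
    ((intervalIntegrable_iff_integrableOn_Icc_of_le ht).1 hh).integrable_indicator
      measurableSet_Icc
  set F := (Icc 0 t).indicator f with hF
  set G := (Icc 0 t).indicator g
  set S := (Icc 0 t).indicator k with hS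
  have hFi : Integrable F := hind hf
  have hGi : Integrable G := hind hg
  have hSi : Integrable S := (hk.integrableOn_compact isCompact_Icc).integrable_indicator
    measurableSet_Icc
  obtain ⟨M, hM⟩ := isCompact_Icc.exists_bound_of_continuousOn hk
  have hM0 : 0 ≤ M := (norm_nonneg _).trans (hM 0 ⟨le_rfl, ht⟩)
  have hSM (s : ℝ) : ‖S s‖ ≤ M := by
    by_cases hs : s ∈ Icc 0 t
    · simpa [hS, hs] using hM s hs
    · simpa [hS, hs] using hM0
  have hGS := hGi.norm.integrable_convolution (mul ℝ ℝ) hSi.norm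
  have hassoc := convolution_assoc (mul ℝ ℝ) (mul ℝ ℝ) (mul ℝ ℝ) (mul ℝ ℝ)
    (fun x y z => mul_assoc x y z) (x₀ := t) hFi.aestronglyMeasurable hGi.aestronglyMeasurable
    hSi.aestronglyMeasurable (hFi.ae_convolution_exists (mul ℝ ℝ) hGi)
    (hGi.norm.ae_convolution_exists (mul ℝ ℝ) hSi.norm) (by
      refine hFi.norm.mul_bdd (c := ∫ s, ‖G s‖ * M)
        (hGS.comp_sub_left t).aestronglyMeasurable (Filter.Eventually.of_forall fun s => ?_)
      refine norm_integral_le_of_norm_le (hGi.norm.mul_const _)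
        (Filter.Eventually.of_forall fun u => ?_)
      simp only [mul_apply', norm_mul, norm_norm]
      gcongr
      exact hSM _)
  rw [convolution_eq_swap, convolution_eq_swap] at hassoc
  rw [intervalIntegral.integral_of_le ht, intervalIntegral.integral_of_le ht,
    ← integral_Icc_eq_integral_Ioc, ← integral_Icc_eq_integral_Ioc,
    ← integral_indicator measurableSet_Icc, ← integral_indicator measurableSet_Icc]
  refine Eq.trans ?_ (hassoc.symm.trans ?_)
  · congr 1 with s
    by_cases hs : s ∈ Icc 0 t
    · have hs' : t - s ∈ Icc 0 t := ⟨by linarith [hs.2], by linarith [hs.1]⟩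
      rw [indicator_of_mem hs, mul_apply', hF, indicator_of_mem hs',
        convolution_indicator_eq_intervalIntegral hs.1 hs.2]
    · rw [indicator_of_notMem hs, mul_apply']
      by_cases hs0 : s < 0
      · rw [convolution_indicator_eq_zero_of_neg hs0, mul_zero]
      · rw [hF, indicator_of_notMem, zero_mul]
        intro h
        exact hs ⟨not_lt.1 hs0, by linarith [h.1]⟩
  · congr 1 with s
    by_cases hs : s ∈ Icc 0 t
    · rw [indicator_of_mem hs, mul_apply', hS, indicator_of_mem hs,
        convolution_indicator_eq_intervalIntegral (by linarith [hs.2]) (by linarith [hs.1])]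
    · rw [indicator_of_notMem hs, mul_apply', hS, indicator_of_notMem hs, mul_zero]

/-- Let `α ∈ (0,1]`, `η, E > 0`, `τ = η/E`, and `σ : [0,1] → ℝ` continuous.  The function
`ε(t) = (1/η^α) ∫₀ᵗ (t−s)^{α−1} E_{α,α}(−((t−s)/τ)^α) σ(s) ds` satisfies `ε(0) = 0`
and the Volterra integral equation of the second kind
`ε(t) = (1/(η^α Γ(α))) ∫₀ᵗ (t−s)^{α−1} σ(s) ds − (1/(τ^α Γ(α))) ∫₀ᵗ (t−s)^{α−1} ε(s) ds`. -/
theorem fractional_strain_solves_volterra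
    (α η E : ℝ) (hα : α ∈ Set.Ioc (0:ℝ) 1) (hη : 0 < η) (hE : 0 < E)
    (τ : ℝ) (hτ : τ = η / E)
    (σ : ℝ → ℝ) (hσ : ContinuousOn σ (Set.Icc 0 1))
    (ε : ℝ → ℝ)
    (hε : ∀ t ∈ Set.Icc (0:ℝ) 1, ε t =
      (1 / η ^ α) * ∫ s in (0:ℝ)..t,
        (t - s) ^ (α - 1) * mittagLeffler α α (-(((t - s) / τ) ^ α)) * σ s) :
    ε 0 = 0 ∧
    ∀ t ∈ Set.Icc (0:ℝ) 1, ε t =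
      (1 / (η ^ α * Real.Gamma α)) * (∫ s in (0:ℝ)..t, (t - s) ^ (α - 1) * σ s)
      - (1 / (τ ^ α * Real.Gamma α)) * ∫ s in (0:ℝ)..t, (t - s) ^ (α - 1) * ε s := by
  obtain ⟨hα0, -⟩ := hα
  have hτ0 : 0 < τ := hτ ▸ div_pos hη hE
  refine ⟨by simp [hε 0 ⟨le_rfl, zero_le_one⟩], fun t ht => ?_⟩
  set c : ℝ := 1 / τ ^ α with hc
  have hscale {x : ℝ} (hx : 0 ≤ x) : (x / τ) ^ α = c * x ^ α := by
    rw [Real.div_rpow hx hτ0.le, hc]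
    ring
  set P : ℝ → ℝ := fun x => x ^ (α - 1)
  set K : ℝ → ℝ := fun x => x ^ (α - 1) * mittagLeffler α α (-(c * x ^ α))
  have hP : IntervalIntegrable P MeasureTheory.volume 0 t :=
    intervalIntegral.intervalIntegrable_rpow' (by linarith)
  have hK : IntervalIntegrable K MeasureTheory.volume 0 t := by
    refine hP.mul_continuousOn (Continuous.continuousOn ?_)
    exact (continuous_mittagLeffler hα0 hα0).comp
      ((Real.continuous_rpow_const hα0.le).const_mul c).neg
  have hσt : ContinuousOn σ (Set.Icc 0 t) := hσ.mono (Set.Icc_subset_Icc_right ht.2)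
  have hmulσ {f : ℝ → ℝ} (hf : IntervalIntegrable f MeasureTheory.volume 0 t) :
      IntervalIntegrable (fun s => f (t - s) * σ s) MeasureTheory.volume 0 t := by
    refine IntervalIntegrable.mul_continuousOn ?_ (by rwa [Set.uIcc_of_le ht.1])
    simpa using (hf.comp_sub_left t).symm
  have hεK {s : ℝ} (hs : s ∈ Set.Icc 0 1) :
      ε s = (1 / η ^ α) * ∫ u in (0 : ℝ)..s, K (s - u) * σ u := by
    rw [hε s hs]
    congr 1
    refine intervalIntegral.integral_congr fun u hu => ?_
    rw [Set.uIcc_of_le hs.1] at hu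
    simp only [K]
    rw [hscale (sub_nonneg.2 hu.2)]
  have hPε : ∫ s in (0 : ℝ)..t, P (t - s) * ε s = (1 / η ^ α) *
      ∫ s in (0 : ℝ)..t, (∫ u in (0 : ℝ)..(t - s), P (t - s - u) * K u) * σ s := by
    rw [← intervalIntegral_volterra_assoc ht.1 hP hK hσt, ← intervalIntegral.integral_const_mul]
    refine intervalIntegral.integral_congr fun s hs => ?_
    rw [Set.uIcc_of_le ht.1] at hs
    rw [hεK ⟨hs.1, hs.2.trans ht.2⟩]
    ring
  have hres : (c / Real.Gamma α) *
      ∫ s in (0 : ℝ)..t, (∫ u in (0 : ℝ)..(t - s), P (t - s - u) * K u) * σ s =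
      (1 / Real.Gamma α) * (∫ s in (0 : ℝ)..t, P (t - s) * σ s) -
        ∫ s in (0 : ℝ)..t, K (t - s) * σ s := by
    rw [← intervalIntegral.integral_const_mul, ← intervalIntegral.integral_const_mul,
      ← intervalIntegral.integral_sub ((hmulσ hP).const_mul _) (hmulσ hK)]
    refine intervalIntegral.integral_congr_Ioo_of_le ht.1 fun s hs => ?_
    have hKres : K (t - s) = (1 / Real.Gamma α) * P (t - s) -
        (c / Real.Gamma α) * ∫ u in (0 : ℝ)..(t - s), P (t - s - u) * K u :=
      rpow_mul_mittagLeffler_eq_sub hα0 (sub_pos.2 hs.2)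
    rw [hKres]
    ring
  change ε t = (1 / (η ^ α * Real.Gamma α)) * (∫ s in (0 : ℝ)..t, P (t - s) * σ s) -
    (1 / (τ ^ α * Real.Gamma α)) * ∫ s in (0 : ℝ)..t, P (t - s) * ε s
  rw [hPε, hεK ht, ← one_div_mul_one_div (τ ^ α), ← hc, ← one_div_mul_one_div (η ^ α)]
  linear_combination (1 / η ^ α) * hres
end

section
/- Let 0 < α ≤ 1 and β ≥ α. Then the function t ↦ E_{α,β}(−t) is nonnegative and antitone (monotonically decreasing) on [0, ∞); in particular, for all t ≥ 0 one has 0 ≤ E_{α,β}(−t) ≤ E_{α,β}(0) = 1/Γ(β). -/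
open Filter Topology Finset

/-- The coefficient of `zⁿ` in the expansion of `(1 - z)^(-s)`. -/
noncomputable def negBinomCoeff (s : ℝ) (n : ℕ) : ℝ := ∏ j ∈ range n, (s + j) / (j + 1)

lemma negBinomCoeff_zero (s : ℝ) : negBinomCoeff s 0 = 1 := by simp [negBinomCoeff]

lemma negBinomCoeff_succ (s : ℝ) (n : ℕ) :
    negBinomCoeff s (n + 1) = negBinomCoeff s n * ((s + n) / (n + 1)) := by
  rw [negBinomCoeff, prod_range_succ, negBinomCoeff]

lemma succ_mul_negBinomCoeff_succ (s : ℝ) (n : ℕ) :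
    ((n : ℝ) + 1) * negBinomCoeff s (n + 1) = (s + n) * negBinomCoeff s n := by
  rw [negBinomCoeff_succ]
  field_simp

lemma negBinomCoeff_nonneg {s : ℝ} (hs : 0 ≤ s) (n : ℕ) : 0 ≤ negBinomCoeff s n :=
  prod_nonneg fun _ _ => by positivity

lemma negBinomCoeff_zero_succ (n : ℕ) : negBinomCoeff 0 (n + 1) = 0 :=
  prod_eq_zero (mem_range.2 n.succ_pos) (by simp)

lemma negBinomCoeff_neg_succ_nonpos {a : ℝ} (h0 : 0 ≤ a) (h1 : a ≤ 1) (n : ℕ) :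
    negBinomCoeff (-a) (n + 1) ≤ 0 := by
  induction n with
  | zero => simp [negBinomCoeff, h0]
  | succ n ih =>
    rw [negBinomCoeff_succ]
    refine mul_nonpos_of_nonpos_of_nonneg ih (div_nonneg ?_ (by positivity))
    push_cast
    linarith [(Nat.cast_nonneg n : (0 : ℝ) ≤ n)]

lemma negBinomCoeff_le_pow {s : ℝ} (hs : 0 ≤ s) (n : ℕ) : negBinomCoeff s n ≤ (s + n) ^ n := by
  have h : negBinomCoeff s n ≤ ∏ _j ∈ range n, (s + n) := by
    refine prod_le_prod (fun _ _ => by positivity) fun j hj => ?_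
    have hj' : (j : ℝ) ≤ n := by exact_mod_cast (mem_range.1 hj).le
    have hj0 : (0 : ℝ) ≤ j := j.cast_nonneg
    exact (div_le_self (by positivity) (by linarith)).trans (by linarith)
  simpa using h

/-- The Chu–Vandermonde identity `(1 - z)^(-a) (1 - z)^(-b) = (1 - z)^(-(a + b))`. -/
lemma sum_negBinomCoeff_mul (a b : ℝ) (n : ℕ) :
    ∑ p ∈ antidiagonal n, negBinomCoeff a p.1 * negBinomCoeff b p.2 = negBinomCoeff (a + b) n := by
  induction n with
  | zero => simp [negBinomCoeff_zero]
  | succ n ih =>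
    have hn : ((n : ℝ) + 1) ≠ 0 := by positivity
    apply mul_left_cancel₀ hn
    rw [succ_mul_negBinomCoeff_succ, ← ih, mul_sum, mul_sum]
    have h1 : ∀ p ∈ antidiagonal (n + 1),
        ((n : ℝ) + 1) * (negBinomCoeff a p.1 * negBinomCoeff b p.2) =
          p.1 * negBinomCoeff a p.1 * negBinomCoeff b p.2 +
          p.2 * negBinomCoeff b p.2 * negBinomCoeff a p.1 := by
      intro p hp
      have : (p.1 : ℝ) + p.2 = n + 1 := by exact_mod_cast mem_antidiagonal.1 hp
      rw [← this]
      ring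
    rw [sum_congr rfl h1, sum_add_distrib, Nat.sum_antidiagonal_succ, Nat.sum_antidiagonal_succ']
    simp only [Nat.cast_zero, zero_mul, zero_add, Nat.cast_add, Nat.cast_one,
      succ_mul_negBinomCoeff_succ]
    rw [← sum_add_distrib]
    refine sum_congr rfl fun p hp => ?_
    have : (p.1 : ℝ) + p.2 = n := by exact_mod_cast mem_antidiagonal.1 hp
    rw [← this]
    ring

/-- A bound for the growth of the coefficients of `(1 - z)^(-s)` in the exponent `s`. -/
lemma negBinomCoeff_add_le {a s : ℝ} (h0 : 0 ≤ a) (h1 : a ≤ 1) (hs : 1 < s) (n : ℕ) :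
    negBinomCoeff (s + a) n ≤ ((s - 1 + n) / (s - 1)) ^ a * negBinomCoeff s n := by
  have hs1 : 0 < s - 1 := by linarith
  induction n with
  | zero => simp [negBinomCoeff_zero, div_self hs1.ne']
  | succ n ih =>
    rw [negBinomCoeff_succ, negBinomCoeff_succ]
    have hx : 0 < s - 1 + n := by positivity
    have hx1 : 0 < s + n := by linarith
    have key : s + a + n ≤ ((s + n) / (s - 1 + n)) ^ a * (s + n) := by
      have hb : ((s - 1 + n) / (s + n)) ^ a ≤ 1 - a / (s + n) := by
        have := rpow_one_add_le_one_add_mul_self (s := -(1 / (s + n))) (p := a)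
          (by rw [neg_le_neg_iff, div_le_one hx1]; linarith [(Nat.cast_nonneg n : (0 : ℝ) ≤ n)])
          h0 h1
        have e : (s - 1 + n) / (s + n) = 1 + -(1 / (s + n)) := by field_simp; ring
        rw [e]
        refine this.trans (le_of_eq (by ring))
      have hp : 0 < ((s - 1 + n) / (s + n)) ^ a := by positivity
      have e : ((s + n) / (s - 1 + n)) ^ a = (((s - 1 + n) / (s + n)) ^ a)⁻¹ := by
        rw [← Real.inv_rpow (by positivity), inv_div]
      rw [e, inv_mul_eq_div, le_div_iff₀ hp]
      calc (s + a + n) * ((s - 1 + n) / (s + n)) ^ a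
          ≤ (s + a + n) * (1 - a / (s + n)) := by gcongr
        _ = (s + n) - a ^ 2 / (s + n) := by field_simp; ring
        _ ≤ s + n := by linarith [show 0 ≤ a ^ 2 / (s + n) by positivity]
    have e : ((s - 1 + (n + 1 : ℕ)) / (s - 1)) ^ a =
        ((s - 1 + n) / (s - 1)) ^ a * ((s + n) / (s - 1 + n)) ^ a := by
      rw [← Real.mul_rpow (by positivity) (by positivity)]
      congr 1
      push_cast
      field_simp
      ring
    rw [e]
    have hr := negBinomCoeff_nonneg (s := s) (by linarith) n
    calc negBinomCoeff (s + a) n * ((s + a + n) / (n + 1))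
        ≤ (((s - 1 + n) / (s - 1)) ^ a * negBinomCoeff s n) *
          ((((s + n) / (s - 1 + n)) ^ a * (s + n)) / (n + 1)) := by gcongr
      _ = _ := by ring

lemma tendsto_rpow_mul_negBinomCoeff {s : ℝ} (hs : 0 < s) :
    Tendsto (fun n : ℕ => (n : ℝ) ^ (1 - s) * negBinomCoeff s n) atTop
      (𝓝 (1 / Real.Gamma s)) := by
  have h1 : Tendsto (fun n : ℕ => (n : ℝ) / (n + s)) atTop (𝓝 1) :=
    tendsto_natCast_div_add_atTop s
  have h2 := h1.div (Real.GammaSeq_tendsto_Gamma s) (Real.Gamma_pos_of_pos hs).ne'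
  refine h2.congr' ?_
  filter_upwards [eventually_gt_atTop 0] with n hn
  have hn' : (0 : ℝ) < n := by exact_mod_cast hn
  have hp : ∏ j ∈ range n, (s + j) ≠ 0 := (prod_pos fun _ _ => by positivity).ne'
  have hf : ∏ j ∈ range n, ((j : ℝ) + 1) = n.factorial := by
    rw [← prod_range_add_one_eq_factorial]
    push_cast
    rfl
  have hns := (Real.rpow_pos_of_pos hn' s).ne'
  simp only [Pi.div_apply, Real.GammaSeq, negBinomCoeff]
  rw [prod_div_distrib, hf, prod_range_succ, Real.rpow_sub hn', Real.rpow_one]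
  field_simp
  ring

lemma summable_mul_negBinomCoeff {α β c : ℝ} (hα : 0 ≤ α) (hβ : 0 ≤ β) (h0 : 0 ≤ c) (h1 : c < 1)
    (n : ℕ) : Summable fun k : ℕ => (-c) ^ k * negBinomCoeff (α * k + β) n := by
  have hc : ‖c‖ < 1 := by rwa [Real.norm_of_nonneg h0]
  have hs := (((summable_pow_mul_geometric_of_norm_lt_one n hc).mul_left (α ^ n)).add
    ((summable_geometric_of_norm_lt_one hc).mul_left ((β + n) ^ n))).mul_left (2 ^ (n - 1))
  refine Summable.of_norm_bounded hs fun k => ?_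
  have hk : (0 : ℝ) ≤ α * k + β := by positivity
  rw [norm_mul, norm_pow, norm_neg, Real.norm_of_nonneg h0,
    Real.norm_of_nonneg (negBinomCoeff_nonneg hk n)]
  calc c ^ k * negBinomCoeff (α * k + β) n
      ≤ c ^ k * (2 ^ (n - 1) * ((α * k) ^ n + (β + n) ^ n)) := by
        gcongr
        refine (negBinomCoeff_le_pow hk n).trans ?_
        rw [add_assoc]
        exact add_pow_le (by positivity) (by positivity) n
    _ = _ := by ring

/-- The coefficient of `zⁿ` in the expansion of `(1 - z)^(α - β) / (c + (1 - z)^α)`. -/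
noncomputable def discreteMittagLeffler (α β c : ℝ) (n : ℕ) : ℝ :=
  ∑' k : ℕ, (-c) ^ k * negBinomCoeff (α * k + β) n

lemma sum_negBinomCoeff_mul_discreteMittagLeffler {α β c : ℝ} (hα : 0 ≤ α) (hβ : 0 ≤ β)
    (h0 : 0 ≤ c) (h1 : c < 1) (γ : ℝ) (n : ℕ) :
    ∑ p ∈ antidiagonal n, negBinomCoeff γ p.1 * discreteMittagLeffler α β c p.2 =
      discreteMittagLeffler α (γ + β) c n := by
  simp only [discreteMittagLeffler, ← tsum_mul_left]
  have hsum : ∀ p ∈ antidiagonal n, Summable fun k : ℕ =>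
      negBinomCoeff γ p.1 * ((-c) ^ k * negBinomCoeff (α * k + β) p.2) := fun p _ =>
    (summable_mul_negBinomCoeff hα hβ h0 h1 p.2).mul_left _
  rw [← Summable.tsum_finsetSum hsum]
  refine tsum_congr fun k => ?_
  rw [show α * k + (γ + β) = γ + (α * k + β) by ring, ← sum_negBinomCoeff_mul, mul_sum]
  exact sum_congr rfl fun p _ => by ring

lemma discreteMittagLeffler_zero {α c : ℝ} (hα : 0 ≤ α) (h0 : 0 ≤ c) (h1 : c < 1) (n : ℕ) :
    discreteMittagLeffler α 0 c n = negBinomCoeff 0 n - c * discreteMittagLeffler α α c n := by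
  rw [discreteMittagLeffler, (summable_mul_negBinomCoeff hα le_rfl h0 h1 n).tsum_eq_zero_add,
    discreteMittagLeffler, ← tsum_mul_left, sub_eq_add_neg, ← tsum_neg]
  congr 1
  · simp
  · refine tsum_congr fun k => ?_
    push_cast
    rw [show α * (k + 1) + 0 = α * k + α by ring]
    ring

lemma one_add_mul_discreteMittagLeffler_zero {α c : ℝ} (hα : 0 ≤ α) (h0 : 0 ≤ c) (h1 : c < 1) :
    (1 + c) * discreteMittagLeffler α α c 0 = 1 := by
  have h := sum_negBinomCoeff_mul_discreteMittagLeffler hα hα h0 h1 (-α) 0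
  rw [neg_add_cancel, discreteMittagLeffler_zero hα h0 h1] at h
  simp only [Nat.antidiagonal_zero, sum_singleton, negBinomCoeff_zero] at h
  linarith

lemma one_add_mul_discreteMittagLeffler_succ {α c : ℝ} (hα : 0 ≤ α) (h0 : 0 ≤ c) (h1 : c < 1)
    (n : ℕ) : (1 + c) * discreteMittagLeffler α α c (n + 1) =
      ∑ p ∈ antidiagonal n, -negBinomCoeff (-α) (p.1 + 1) * discreteMittagLeffler α α c p.2 := by
  have h := sum_negBinomCoeff_mul_discreteMittagLeffler hα hα h0 h1 (-α) (n + 1)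
  rw [neg_add_cancel, discreteMittagLeffler_zero hα h0 h1, Nat.sum_antidiagonal_succ,
    negBinomCoeff_zero, negBinomCoeff_zero_succ] at h
  simp only [neg_mul, sum_neg_distrib]
  linarith

lemma discreteMittagLeffler_self_nonneg_and_le {α c d : ℝ} (hα : 0 ≤ α) (hα1 : α ≤ 1) (h0 : 0 ≤ c)
    (hcd : c ≤ d) (h1 : d < 1) (n : ℕ) :
    0 ≤ discreteMittagLeffler α α d n ∧
      discreteMittagLeffler α α d n ≤ discreteMittagLeffler α α c n := by
  have hd0 : 0 ≤ d := h0.trans hcd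
  have hc1 : c < 1 := hcd.trans_lt h1
  have cancel {x y : ℝ} (hx : 0 ≤ (1 + d) * x) (hxy : (1 + d) * x ≤ (1 + c) * y) :
      0 ≤ x ∧ x ≤ y := by
    have hx' : 0 ≤ x := nonneg_of_mul_nonneg_right hx (by linarith)
    refine ⟨hx', le_of_mul_le_mul_left (a := 1 + c) ?_ (by linarith)⟩
    nlinarith
  induction n using Nat.strong_induction_on with
  | _ n ih =>
    apply cancel
    all_goals rcases n with _ | n
    · simp [one_add_mul_discreteMittagLeffler_zero hα hd0 h1]
    · rw [one_add_mul_discreteMittagLeffler_succ hα hd0 h1]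
      refine sum_nonneg fun p hp => mul_nonneg ?_ (ih _ (Finset.Nat.antidiagonal.snd_lt hp)).1
      linarith [negBinomCoeff_neg_succ_nonpos hα hα1 p.1]
    · rw [one_add_mul_discreteMittagLeffler_zero hα hd0 h1,
        one_add_mul_discreteMittagLeffler_zero hα h0 hc1]
    · rw [one_add_mul_discreteMittagLeffler_succ hα hd0 h1,
        one_add_mul_discreteMittagLeffler_succ hα h0 hc1]
      refine sum_le_sum fun p hp =>
        mul_le_mul_of_nonneg_left (ih _ (Finset.Nat.antidiagonal.snd_lt hp)).2 ?_
      linarith [negBinomCoeff_neg_succ_nonpos hα hα1 p.1]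

lemma discreteMittagLeffler_nonneg_and_le {α β c d : ℝ} (hα : 0 ≤ α) (hα1 : α ≤ 1) (hβ : α ≤ β)
    (h0 : 0 ≤ c) (hcd : c ≤ d) (h1 : d < 1) (n : ℕ) :
    0 ≤ discreteMittagLeffler α β d n ∧
      discreteMittagLeffler α β d n ≤ discreteMittagLeffler α β c n := by
  have hγ : 0 ≤ β - α := sub_nonneg.2 hβ
  have hd := sum_negBinomCoeff_mul_discreteMittagLeffler hα hα (h0.trans hcd) h1 (β - α) n
  have hc := sum_negBinomCoeff_mul_discreteMittagLeffler hα hα h0 (hcd.trans_lt h1) (β - α) n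
  rw [sub_add_cancel] at hd hc
  have H := discreteMittagLeffler_self_nonneg_and_le hα hα1 h0 hcd h1
  rw [← hd, ← hc]
  exact ⟨sum_nonneg fun p _ => mul_nonneg (negBinomCoeff_nonneg hγ _) (H _).1,
    sum_le_sum fun p _ => mul_le_mul_of_nonneg_left (H _).2 (negBinomCoeff_nonneg hγ _)⟩

/-- The rescaled coefficient `n^(1-s) [zⁿ] (1 - z)^(-s)` decays fast in `s`, uniformly in `n`. -/
lemma rpow_mul_negBinomCoeff_add_le {a s : ℝ} (h0 : 0 ≤ a) (h1 : a ≤ 1) (hs : 1 < s) {n : ℕ}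
    (hn : 0 < n) :
    (n : ℝ) ^ (1 - (s + a)) * negBinomCoeff (s + a) n ≤
      (1 / n + 1 / (s - 1)) ^ a * ((n : ℝ) ^ (1 - s) * negBinomCoeff s n) := by
  have hn' : (0 : ℝ) < n := by exact_mod_cast hn
  have hs1 : 0 < s - 1 := by linarith
  have e : ((1 : ℝ) / n + 1 / (s - 1)) ^ a = ((s - 1 + n) / (s - 1)) ^ a / (n : ℝ) ^ a := by
    rw [← Real.div_rpow (by positivity) (by positivity)]
    congr 1
    field_simp
  calc (n : ℝ) ^ (1 - (s + a)) * negBinomCoeff (s + a) n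
      ≤ (n : ℝ) ^ (1 - (s + a)) * (((s - 1 + n) / (s - 1)) ^ a * negBinomCoeff s n) := by
        gcongr
        exact negBinomCoeff_add_le h0 h1 hs n
    _ = _ := by
        rw [e, ← sub_sub, Real.rpow_sub hn' (1 - s) a]
        ring

lemma exists_summable_bound {α β : ℝ} (hα : 0 < α) (hα1 : α ≤ 1) (hβ : 0 < β) {t : ℝ}
    (ht : 0 ≤ t) :
    ∃ u : ℕ → ℝ, Summable u ∧ ∀ᶠ n : ℕ in atTop, ∀ k : ℕ,
      t ^ k * ((n : ℝ) ^ (1 - (α * k + β)) * negBinomCoeff (α * k + β) n) ≤ u k := by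
  have hlim : Tendsto (fun ε : ℝ => t * (ε + ε) ^ α) (𝓝 0) (𝓝 0) := by
    have : ContinuousAt (fun ε : ℝ => t * (ε + ε) ^ α) 0 :=
      continuousAt_const.mul ((continuousAt_id.add continuousAt_id).rpow_const (Or.inr hα.le))
    simpa [ContinuousAt, Real.zero_rpow hα.ne'] using this
  obtain ⟨ε, hε, hε0⟩ : ∃ ε : ℝ, t * (ε + ε) ^ α < 1 / 2 ∧ 0 < ε :=
    (((hlim.mono_left nhdsWithin_le_nhds).eventually_lt_const (by norm_num)).and
      (self_mem_nhdsWithin : Set.Ioi (0 : ℝ) ∈ 𝓝[>] 0)).exists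
  obtain ⟨K, hK⟩ := exists_nat_gt ((1 + 1 / ε) / α)
  rw [div_lt_iff₀ hα] at hK
  set M : ℕ → ℝ := fun k => t ^ k * (1 / Real.Gamma (α * k + β)) + 1 with hM
  refine ⟨fun k => if k < K then M k else M K * (1 / 2) ^ (k - K), ?_, ?_⟩
  · rw [← summable_nat_add_iff K]
    refine (summable_geometric_two.mul_left (M K)).congr fun k => ?_
    simp
  have hfirst : ∀ᶠ n : ℕ in atTop, ∀ k ∈ range (K + 1),
      t ^ k * ((n : ℝ) ^ (1 - (α * k + β)) * negBinomCoeff (α * k + β) n) < M k := by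
    rw [Filter.eventually_all_finset]
    intro k _
    refine ((tendsto_rpow_mul_negBinomCoeff (s := α * k + β) (by positivity)).const_mul
      (t ^ k)).eventually_lt_const ?_
    simp [hM]
  have hn_large : ∀ᶠ n : ℕ in atTop, 1 / ε < (n : ℝ) :=
    tendsto_natCast_atTop_atTop.eventually_gt_atTop _
  filter_upwards [hfirst, hn_large, eventually_gt_atTop 0] with n h1 h2 h3 k
  have hn' : (0 : ℝ) < n := by exact_mod_cast h3
  have htail (m : ℕ) : t ^ (K + m) * ((n : ℝ) ^ (1 - (α * (K + m : ℕ) + β)) *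
      negBinomCoeff (α * (K + m : ℕ) + β) n) ≤ M K * (1 / 2) ^ m := by
    induction m with
    | zero => simpa using (h1 K (by simp)).le
    | succ m ih =>
      set s : ℝ := α * (K + m : ℕ) + β with hs
      have hsε : 1 / ε < s - 1 := by
        have : 0 ≤ α * (m : ℝ) := by positivity
        rw [hs]
        push_cast
        linarith
      have hs1 : 1 < s := by linarith [show 0 < 1 / ε by positivity]
      have e : α * ((K + (m + 1) : ℕ) : ℝ) + β = s + α := by
        rw [hs]
        push_cast
        ring
      have hb0 : 0 ≤ (n : ℝ) ^ (1 - s) * negBinomCoeff s n :=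
        mul_nonneg (by positivity) (negBinomCoeff_nonneg (by linarith) n)
      have hs1' : 0 < s - 1 := by linarith
      have hle1 : 1 / (n : ℝ) ≤ ε := (one_div_lt hε0 hn').1 h2 |>.le
      have hle2 : 1 / (s - 1) ≤ ε := (one_div_lt hε0 hs1').1 hsε |>.le
      rw [e]
      calc t ^ (K + (m + 1)) * ((n : ℝ) ^ (1 - (s + α)) * negBinomCoeff (s + α) n)
          ≤ t ^ (K + (m + 1)) * ((1 / n + 1 / (s - 1)) ^ α *
            ((n : ℝ) ^ (1 - s) * negBinomCoeff s n)) := by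
            refine mul_le_mul_of_nonneg_left ?_ (by positivity)
            exact rpow_mul_negBinomCoeff_add_le hα.le hα1 hs1 h3
        _ ≤ t ^ (K + (m + 1)) * ((ε + ε) ^ α *
            ((n : ℝ) ^ (1 - s) * negBinomCoeff s n)) := by gcongr
        _ = (t * (ε + ε) ^ α) *
            (t ^ (K + m) * ((n : ℝ) ^ (1 - s) * negBinomCoeff s n)) := by ring
        _ ≤ (1 / 2) * (M K * (1 / 2) ^ m) := by gcongr
        _ = M K * (1 / 2) ^ (m + 1) := by ring
  by_cases hk : k < K
  · simpa [hk] using (h1 k (by simp; omega)).le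
  · obtain ⟨m, rfl⟩ := Nat.exists_eq_add_of_le (not_lt.1 hk)
    simpa using htail m

/-- The Mittag-Leffler function as a scaling limit of its discrete analogue. -/
lemma tendsto_discreteMittagLeffler {α β : ℝ} (hα : 0 < α) (hα1 : α ≤ 1) (hβ : 0 < β) {t : ℝ}
    (ht : 0 ≤ t) :
    Tendsto (fun n : ℕ => (n : ℝ) ^ (1 - β) * discreteMittagLeffler α β (t / (n : ℝ) ^ α) n) atTop
      (𝓝 (mittagLeffler α β (-t))) := by
  obtain ⟨u, hu, hbound⟩ := exists_summable_bound hα hα1 hβ ht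
  have h := tendsto_tsum_of_dominated_convergence (𝓕 := atTop)
    (f := fun (n : ℕ) (k : ℕ) =>
      (-t) ^ k * ((n : ℝ) ^ (1 - (α * k + β)) * negBinomCoeff (α * k + β) n))
    (g := fun k : ℕ => (-t) ^ k / Real.Gamma (α * k + β)) hu
    (fun k => by
      have := (tendsto_rpow_mul_negBinomCoeff (s := α * k + β) (by positivity)).const_mul ((-t) ^ k)
      rwa [mul_one_div] at this)
    (by
      filter_upwards [hbound] with n hn k
      have hnn : 0 ≤ (n : ℝ) ^ (1 - (α * k + β)) * negBinomCoeff (α * k + β) n :=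
        mul_nonneg (by positivity) (negBinomCoeff_nonneg (by positivity) n)
      rw [norm_mul, norm_pow, norm_neg, Real.norm_of_nonneg ht, Real.norm_of_nonneg hnn]
      exact hn k)
  refine h.congr' ?_
  filter_upwards [eventually_gt_atTop 0] with n hn
  have hn' : (0 : ℝ) < n := by exact_mod_cast hn
  rw [discreteMittagLeffler, ← tsum_mul_left]
  refine tsum_congr fun k => ?_
  rw [show 1 - (α * k + β) = (1 - β) - α * k by ring, Real.rpow_sub hn', Real.rpow_mul hn'.le,
    Real.rpow_natCast, ← neg_div, div_pow]
  ring

lemma eventually_div_rpow_lt_one {α : ℝ} (hα : 0 < α) (t : ℝ) :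
    ∀ᶠ n : ℕ in atTop, t / (n : ℝ) ^ α < 1 :=
  (((tendsto_rpow_atTop hα).comp tendsto_natCast_atTop_atTop).const_div_atTop t).eventually_lt_const
    one_pos

/-- For `0 < α ≤ 1` and `β ≥ α`, the function `t ↦ E_{α,β}(−t)` is nonnegative and
antitone on `[0,∞)`; in particular `0 ≤ E_{α,β}(−t) ≤ E_{α,β}(0) = 1/Γ(β)` for `t ≥ 0`. -/
theorem mittagLeffler_neg_antitoneOn_nonneg
    (α β : ℝ) (hα : α ∈ Set.Ioc (0:ℝ) 1) (hβ : α ≤ β) :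
    (∀ t ∈ Set.Ici (0:ℝ), 0 ≤ mittagLeffler α β (-t)) ∧
    AntitoneOn (fun t => mittagLeffler α β (-t)) (Set.Ici 0) ∧
    mittagLeffler α β 0 = 1 / Real.Gamma β ∧
    ∀ t ∈ Set.Ici (0:ℝ), mittagLeffler α β (-t) ≤ 1 / Real.Gamma β := by
  obtain ⟨hα0, hα1⟩ := hα
  have hβ0 : 0 < β := hα0.trans_le hβ
  have hanti : AntitoneOn (fun t => mittagLeffler α β (-t)) (Set.Ici 0) := by
    intro t ht t' ht' htt'
    refine le_of_tendsto_of_tendsto (tendsto_discreteMittagLeffler hα0 hα1 hβ0 ht')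
      (tendsto_discreteMittagLeffler hα0 hα1 hβ0 ht) ?_
    filter_upwards [eventually_div_rpow_lt_one hα0 t'] with n hn
    refine mul_le_mul_of_nonneg_left (discreteMittagLeffler_nonneg_and_le hα0.le hα1 hβ
      (div_nonneg ht (by positivity)) ?_ hn n).2 (by positivity)
    gcongr
  have hzero : mittagLeffler α β 0 = 1 / Real.Gamma β := by
    rw [mittagLeffler, tsum_eq_single 0 fun n hn => by simp [hn]]
    simp
  refine ⟨fun t ht => ?_, hanti, hzero, fun t ht => ?_⟩
  · refine ge_of_tendsto (tendsto_discreteMittagLeffler hα0 hα1 hβ0 ht) ?_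
    filter_upwards [eventually_div_rpow_lt_one hα0 t] with n hn
    exact mul_nonneg (by positivity) (discreteMittagLeffler_nonneg_and_le hα0.le hα1 hβ
      (div_nonneg ht (by positivity)) le_rfl hn n).1
  · rw [← hzero]
    simpa using hanti Set.self_mem_Ici ht ht
end

section
/- Let α ∈ (0,1], η, τ > 0, let σ: [0,∞) → [0,∞) be continuous, and let η₀ > 0. Suppose ε: [0,1] → ℝ is continuous with 0 ≤ ε(t) ≤ η₀ for all t, and let ρ be any real number with ρ ≥ σ(u) for every u ∈ [0, η₀]. Then for all t₁, t₂ ∈ [0,1] with t₁ ≤ t₂, |(Tε)(t₂) − (Tε)(t₁)| ≤ 2ρ (t₂ − t₁)^α/(η^α Γ(α+1)). -/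
/-- The operator `T` of the nonlinear fractional Voigt model:
`(Tε)(t) = (1/η^α) ∫₀ᵗ (t−s)^{α−1} E_{α,α}(−((t−s)/τ)^α) σ(ε(s)) ds`. -/
noncomputable def voigtOp (α η τ : ℝ) (σ : ℝ → ℝ) (ε : ℝ → ℝ) (t : ℝ) : ℝ :=
  (1 / η ^ α) * ∫ s in (0:ℝ)..t,
    (t - s) ^ (α - 1) * mittagLeffler α α (-(((t - s) / τ) ^ α)) * σ (ε s)

open Filter Topology Finset MeasureTheory intervalIntegral

theorem multichoose_succ_right (β : ℝ) (n : ℕ) :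
    Ring.multichoose β (n + 1) = Ring.multichoose β n * ((β + n) / (n + 1)) := by
  have h1 := Ring.factorial_nsmul_multichoose_eq_ascPochhammer β (n + 1)
  have h2 := Ring.factorial_nsmul_multichoose_eq_ascPochhammer β n
  rw [ascPochhammer_succ_right, Polynomial.smeval_mul, ← h2] at h1
  simp only [nsmul_eq_mul, Nat.factorial_succ, Polynomial.smeval_add, Polynomial.smeval_X,
    Polynomial.smeval_natCast, pow_one, pow_zero, Nat.cast_mul, Nat.cast_add, Nat.cast_one,
    mul_one] at h1
  have h3 : (n.factorial : ℝ) ≠ 0 := by positivity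
  have h4 : (n + 1 : ℝ) ≠ 0 := by positivity
  field_simp
  apply mul_left_cancel₀ h3
  linear_combination h1

theorem multichoose_nonneg {β : ℝ} (hβ : 0 ≤ β) (n : ℕ) : 0 ≤ Ring.multichoose β n := by
  induction n with
  | zero => simp
  | succ n ih => rw [multichoose_succ_right]; positivity

theorem multichoose_neg_succ_nonpos {α : ℝ} (h0 : 0 ≤ α) (h1 : α ≤ 1) (n : ℕ) :
    Ring.multichoose (-α) (n + 1) ≤ 0 := by
  induction n with
  | zero => simpa
  | succ n ih =>
    rw [multichoose_succ_right]
    refine mul_nonpos_of_nonpos_of_nonneg ih (div_nonneg ?_ (by positivity))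
    push_cast
    linarith [n.cast_nonneg (α := ℝ)]

theorem sum_antidiagonal_multichoose_mul (β γ : ℝ) (n : ℕ) :
    ∑ p ∈ antidiagonal n, Ring.multichoose β p.1 * Ring.multichoose γ p.2 =
      Ring.multichoose (β + γ) n := by
  have key : ∀ (r : ℝ) (m : ℕ), Ring.multichoose r m = (-1) ^ m * Ring.choose (-r) m := by
    intro r m
    rw [Ring.choose_neg']
    rcases m.even_or_odd with h | h
    · simp [h.neg_one_pow, Int.negOnePow_even _ ((Int.even_coe_nat m).2 h)]
    · simp [h.neg_one_pow, Int.negOnePow_odd _ ((Int.odd_coe_nat m).2 h)]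
  rw [key (β + γ), neg_add, Ring.add_choose_eq n (Commute.all _ _), Finset.mul_sum]
  refine Finset.sum_congr rfl fun p hp => ?_
  rw [key β, key γ, ← mem_antidiagonal.1 hp, pow_add]
  ring

theorem multichoose_eq_mul_multichoose_add_one (β : ℝ) (n : ℕ) :
    Ring.multichoose β n * (β + n) = β * Ring.multichoose (β + 1) n := by
  induction n with
  | zero => simp
  | succ n ih =>
    rw [multichoose_succ_right, multichoose_succ_right, ← mul_assoc β, ← ih]
    push_cast
    ring

theorem multichoose_add_one_le_pow {β : ℝ} (hβ : 0 ≤ β) (n : ℕ) :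
    Ring.multichoose (β + 1) n ≤ (1 + β) ^ n := by
  induction n with
  | zero => simp
  | succ n ih =>
    rw [multichoose_succ_right, pow_succ]
    refine mul_le_mul ih ?_ (by positivity) (by positivity)
    rw [div_le_iff₀ (by positivity)]
    nlinarith [n.cast_nonneg (α := ℝ), mul_nonneg hβ (n.cast_nonneg (α := ℝ))]

theorem multichoose_le_pow {β : ℝ} (hβ : 0 ≤ β) (n : ℕ) :
    Ring.multichoose β n ≤ (1 + β) ^ n := by
  induction n with
  | zero => simp
  | succ n ih =>
    rw [multichoose_succ_right, pow_succ]
    refine mul_le_mul ih ?_ (by positivity) (by positivity)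
    rw [div_le_iff₀ (by positivity)]
    nlinarith [n.cast_nonneg (α := ℝ), mul_nonneg hβ (n.cast_nonneg (α := ℝ))]

theorem one_add_div_le_rpow {β : ℝ} (hβ : 0 ≤ β) {n : ℕ} (hn : 0 < n) :
    (β + 1 + n) / (n + 1) ≤ (((n + 1 : ℕ) : ℝ) / n) ^ β := by
  have hn' : (0 : ℝ) < n := by exact_mod_cast hn
  have hpos : (0 : ℝ) < ((n + 1 : ℕ) : ℝ) / n := by positivity
  have h := Real.one_sub_inv_le_log_of_pos hpos
  rw [Real.rpow_def_of_pos hpos]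
  refine le_trans ?_ (Real.add_one_le_exp _)
  have h2 : (1 - (((n + 1 : ℕ) : ℝ) / n)⁻¹) = 1 / (n + 1) := by
    push_cast; field_simp; ring
  rw [h2] at h
  have h3 : (β + 1 + n) / (n + 1) = 1 / (n + 1) * β + 1 := by field_simp; ring
  rw [h3]
  gcongr

theorem multichoose_add_one_le_rpow {β : ℝ} (hβ : 0 ≤ β) {M n : ℕ} (hM : 0 < M) (hn : M ≤ n) :
    Ring.multichoose (β + 1) n ≤ (1 + β) ^ M * ((n : ℝ) / M) ^ β := by
  have hM' : (0 : ℝ) < M := by exact_mod_cast hM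
  induction n, hn using Nat.le_induction with
  | base => simpa [hM'.ne'] using multichoose_add_one_le_pow hβ M
  | succ n hn ih =>
    have hn' : 0 < n := hM.trans_le hn
    have hn'' : (0 : ℝ) < n := by exact_mod_cast hn'
    calc Ring.multichoose (β + 1) (n + 1)
        = Ring.multichoose (β + 1) n * ((β + 1 + n) / (n + 1)) := multichoose_succ_right _ _
      _ ≤ ((1 + β) ^ M * ((n : ℝ) / M) ^ β) * (((n + 1 : ℕ) : ℝ) / n) ^ β :=
          mul_le_mul ih (one_add_div_le_rpow hβ hn') (by positivity) (by positivity)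
      _ = (1 + β) ^ M * (((n + 1 : ℕ) : ℝ) / M) ^ β := by
          rw [mul_assoc, ← Real.mul_rpow (by positivity) (by positivity)]
          congr 2
          field_simp

/-- A bound on the rescaled coefficients of `(1 - z) ^ (-β)`, uniform in `n ≥ M`. -/
theorem rpow_mul_multichoose_le {β : ℝ} (hβ : 0 < β) {M n : ℕ} (hM : 0 < M) (hn : M ≤ n) :
    (n : ℝ) ^ (1 - β) * Ring.multichoose β n ≤ (1 + β) ^ (M + 1) * (M : ℝ) ^ (-β) := by
  have hM' : (0 : ℝ) < M := by exact_mod_cast hM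
  have hn' : (0 : ℝ) < n := by exact_mod_cast hM.trans_le hn
  have h1 := multichoose_eq_mul_multichoose_add_one β n
  have h2 := multichoose_add_one_le_rpow hβ.le hM hn
  have h3 : n * Ring.multichoose β n ≤ (1 + β) * ((1 + β) ^ M * ((n : ℝ) / M) ^ β) := by
    have h4 := multichoose_nonneg hβ.le n
    have h5 := multichoose_nonneg (by linarith : 0 ≤ β + 1) n
    nlinarith
  rw [Real.rpow_sub hn', Real.rpow_one, Real.rpow_neg hM'.le]
  rw [Real.div_rpow hn'.le hM'.le] at h3
  have : 0 < (n : ℝ) ^ β := by positivity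
  calc (n : ℝ) / n ^ β * Ring.multichoose β n = (n * Ring.multichoose β n) / n ^ β := by ring
    _ ≤ ((1 + β) * ((1 + β) ^ M * ((n : ℝ) ^ β / M ^ β))) / n ^ β := by gcongr
    _ = _ := by field_simp; ring

theorem tendsto_rpow_mul_multichoose {β : ℝ} (hβ : 0 < β) :
    Tendsto (fun n : ℕ => (n : ℝ) ^ (1 - β) * Ring.multichoose β n) atTop
      (𝓝 (Real.Gamma β)⁻¹) := by
  have h1 := (Real.GammaSeq_tendsto_Gamma β).inv₀ (Real.Gamma_pos_of_pos hβ).ne'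
  have h2 : Tendsto (fun n : ℕ => (n : ℝ) / (n + β)) atTop (𝓝 1) :=
    tendsto_natCast_div_add_atTop β
  have h3 := h2.mul h1
  rw [one_mul] at h3
  refine h3.congr' ?_
  filter_upwards [eventually_gt_atTop 0] with n hn
  have hn' : (0 : ℝ) < n := by exact_mod_cast hn
  have hprod : ∀ m : ℕ, ∏ j ∈ range m, (β + j) = m.factorial * Ring.multichoose β m := by
    intro m
    induction m with
    | zero => simp
    | succ m ih =>
      rw [prod_range_succ, ih, multichoose_succ_right, Nat.factorial_succ]
      push_cast
      field_simp
  have h4 : (0 : ℝ) < (n : ℝ) ^ β := by positivity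
  have h5 : (n.factorial : ℝ) ≠ 0 := by positivity
  rw [Real.GammaSeq, prod_range_succ, hprod, Real.rpow_sub hn', Real.rpow_one]
  field_simp
  ring

theorem summable_add_two_pow_mul_geometric (k : ℕ) {r : ℝ} (h0 : 0 ≤ r) (h1 : r < 1) :
    Summable fun j : ℕ => ((j : ℝ) + 2) ^ k * r ^ j := by
  obtain ⟨s, hrs, hs1⟩ := exists_between h1
  have hs0 : 0 < s := h0.trans_lt hrs
  have h := (summable_nat_add_iff 2).2 (summable_pow_mul_geometric_of_norm_lt_one (R := ℝ) k
    (by rwa [Real.norm_of_nonneg hs0.le] : ‖s‖ < 1))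
  refine Summable.of_nonneg_of_le (fun j => by positivity) (fun j => ?_) (h.mul_left (s ^ 2)⁻¹)
  have : (s ^ 2)⁻¹ * (((j + 2 : ℕ) : ℝ) ^ k * s ^ (j + 2)) = ((j : ℝ) + 2) ^ k * s ^ j := by
    push_cast
    field_simp
    ring
  rw [this]
  gcongr

/-- The `n`-th Taylor coefficient at `0` of `z ↦ 1 / ((1 - z) ^ α + μ)`. -/
noncomputable def resolventCoeff (α μ : ℝ) (n : ℕ) : ℝ :=
  ∑' j : ℕ, (-μ) ^ j * Ring.multichoose (α * j + α) n

theorem summable_resolventCoeff {α μ : ℝ} (hα0 : 0 ≤ α) (hα1 : α ≤ 1) (hμ0 : 0 ≤ μ) (hμ1 : μ < 1)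
    (n : ℕ) : Summable fun j : ℕ => (-μ) ^ j * Ring.multichoose (α * j + α) n := by
  refine Summable.of_norm_bounded (summable_add_two_pow_mul_geometric n hμ0 hμ1) fun j => ?_
  have hβ : 0 ≤ α * j + α := by positivity
  rw [norm_mul, norm_pow, norm_neg, Real.norm_of_nonneg hμ0,
    Real.norm_of_nonneg (multichoose_nonneg hβ n), mul_comm]
  gcongr
  refine (multichoose_le_pow hβ n).trans ?_
  have : 1 + (α * j + α) ≤ (j : ℝ) + 2 := by nlinarith [j.cast_nonneg (α := ℝ)]
  gcongr

theorem sum_antidiagonal_mul_resolventCoeff {α μ : ℝ} (hα0 : 0 ≤ α) (hα1 : α ≤ 1) (hμ0 : 0 ≤ μ)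
    (hμ1 : μ < 1) (n : ℕ) :
    ∑ p ∈ antidiagonal n, Ring.multichoose (-α) p.1 * resolventCoeff α μ p.2 =
      Ring.multichoose (0 : ℝ) n - μ * resolventCoeff α μ n := by
  have hs := summable_resolventCoeff hα0 hα1 hμ0 hμ1
  have hshift : ∀ j : ℕ, (-μ) ^ (j + 1) * Ring.multichoose (α * (j + 1 : ℕ)) n =
      -μ * ((-μ) ^ j * Ring.multichoose (α * j + α) n) := by
    intro j
    push_cast
    rw [mul_add, mul_one]
    ring
  have hsum : Summable fun j : ℕ => (-μ) ^ j * Ring.multichoose (α * j) n := by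
    rw [← summable_nat_add_iff 1]
    simp_rw [hshift]
    exact (hs n).mul_left _
  calc ∑ p ∈ antidiagonal n, Ring.multichoose (-α) p.1 * resolventCoeff α μ p.2
      = ∑ p ∈ antidiagonal n, ∑' j : ℕ,
          Ring.multichoose (-α) p.1 * ((-μ) ^ j * Ring.multichoose (α * j + α) p.2) := by
        simp_rw [resolventCoeff, tsum_mul_left]
    _ = ∑' j : ℕ, ∑ p ∈ antidiagonal n,
          Ring.multichoose (-α) p.1 * ((-μ) ^ j * Ring.multichoose (α * j + α) p.2) :=
        (Summable.tsum_finsetSum fun p _ => (hs p.2).mul_left _).symm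
    _ = ∑' j : ℕ, (-μ) ^ j * Ring.multichoose (α * j) n := by
        congr 1 with j
        have := sum_antidiagonal_multichoose_mul (-α) (α * j + α) n
        rw [show -α + (α * j + α) = α * j by ring] at this
        rw [← this, Finset.mul_sum]
        exact Finset.sum_congr rfl fun p _ => by ring
    _ = _ := by
        rw [hsum.tsum_eq_zero_add]
        simp_rw [hshift]
        rw [tsum_mul_left, resolventCoeff]
        simp
        ring

theorem one_add_mul_resolventCoeff_zero {α μ : ℝ} (hα0 : 0 ≤ α) (hα1 : α ≤ 1) (hμ0 : 0 ≤ μ)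
    (hμ1 : μ < 1) : (1 + μ) * resolventCoeff α μ 0 = 1 := by
  have h := sum_antidiagonal_mul_resolventCoeff hα0 hα1 hμ0 hμ1 0
  simp at h
  linarith

theorem one_add_mul_resolventCoeff_succ {α μ : ℝ} (hα0 : 0 ≤ α) (hα1 : α ≤ 1) (hμ0 : 0 ≤ μ)
    (hμ1 : μ < 1) (n : ℕ) : (1 + μ) * resolventCoeff α μ (n + 1) =
      ∑ p ∈ antidiagonal n, -Ring.multichoose (-α) (p.1 + 1) * resolventCoeff α μ p.2 := by
  have h := sum_antidiagonal_mul_resolventCoeff hα0 hα1 hμ0 hμ1 (n + 1)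
  rw [Finset.Nat.sum_antidiagonal_succ] at h
  simp only [Ring.multichoose_zero_right, Ring.multichoose_zero_succ] at h
  simp_rw [neg_mul, Finset.sum_neg_distrib]
  linarith

theorem resolventCoeff_nonneg {α μ : ℝ} (hα0 : 0 ≤ α) (hα1 : α ≤ 1) (hμ0 : 0 ≤ μ)
    (hμ1 : μ < 1) (n : ℕ) : 0 ≤ resolventCoeff α μ n := by
  have hpos : 0 < 1 + μ := by positivity
  induction n using Nat.strong_induction_on with
  | _ n ih =>
    refine nonneg_of_mul_nonneg_right (a := 1 + μ) ?_ hpos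
    cases n with
    | zero => simp [one_add_mul_resolventCoeff_zero hα0 hα1 hμ0 hμ1]
    | succ n =>
      rw [one_add_mul_resolventCoeff_succ hα0 hα1 hμ0 hμ1]
      refine Finset.sum_nonneg fun p hp => mul_nonneg ?_ (ih _ ?_)
      · exact neg_nonneg.2 (multichoose_neg_succ_nonpos hα0 hα1 _)
      · have := mem_antidiagonal.1 hp
        omega

theorem resolventCoeff_anti {α μ ν : ℝ} (hα0 : 0 ≤ α) (hα1 : α ≤ 1) (hμ0 : 0 ≤ μ)
    (hμν : μ ≤ ν) (hν1 : ν < 1) (n : ℕ) : resolventCoeff α ν n ≤ resolventCoeff α μ n := by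
  have hν0 := hμ0.trans hμν
  have hμ1 := hμν.trans_lt hν1
  have hpos : 0 < 1 + ν := by positivity
  induction n using Nat.strong_induction_on with
  | _ n ih =>
    have h : (1 + ν) * resolventCoeff α ν n ≤ (1 + μ) * resolventCoeff α μ n := by
      cases n with
      | zero =>
        rw [one_add_mul_resolventCoeff_zero hα0 hα1 hμ0 hμ1,
          one_add_mul_resolventCoeff_zero hα0 hα1 hν0 hν1]
      | succ n =>
        rw [one_add_mul_resolventCoeff_succ hα0 hα1 hμ0 hμ1,
          one_add_mul_resolventCoeff_succ hα0 hα1 hν0 hν1]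
        refine Finset.sum_le_sum fun p hp => mul_le_mul_of_nonneg_left (ih _ ?_) ?_
        · have := mem_antidiagonal.1 hp
          omega
        · exact neg_nonneg.2 (multichoose_neg_succ_nonpos hα0 hα1 _)
    refine le_of_mul_le_mul_left (h.trans ?_) hpos
    gcongr
    exact resolventCoeff_nonneg hα0 hα1 hμ0 hμ1 n

/-- The Post–Widder approximation of `E_{α,α}` on the negative half-line. -/
theorem tendsto_rpow_mul_resolventCoeff {α x : ℝ} (hα0 : 0 < α) (hα1 : α ≤ 1) (hx : 0 ≤ x) :
    Tendsto (fun n : ℕ => (n : ℝ) ^ (1 - α) * resolventCoeff α (x * (n : ℝ) ^ (-α)) n) atTop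
      (𝓝 (mittagLeffler α α (-x))) := by
  have hlim : Tendsto (fun n : ℕ => x * (n : ℝ) ^ (-α)) atTop (𝓝 0) := by
    simpa using ((tendsto_rpow_neg_atTop hα0).comp tendsto_natCast_atTop_atTop).const_mul x
  obtain ⟨M, hM1, hM0⟩ := ((hlim.eventually_lt_const one_pos).and (eventually_gt_atTop 0)).exists
  have hM0' : (0 : ℝ) < M := by exact_mod_cast hM0
  have hβ : ∀ j : ℕ, 0 < α * j + α := fun j => by positivity
  have hterm : ∀ᶠ n : ℕ in atTop,
      ∑' j : ℕ, (-x) ^ j * ((n : ℝ) ^ (1 - (α * j + α)) * Ring.multichoose (α * j + α) n) =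
        (n : ℝ) ^ (1 - α) * resolventCoeff α (x * (n : ℝ) ^ (-α)) n := by
    filter_upwards [eventually_gt_atTop 0] with n hn
    have hn' : (0 : ℝ) < n := by exact_mod_cast hn
    rw [resolventCoeff, ← tsum_mul_left]
    congr 1 with j
    have : (n : ℝ) ^ (1 - (α * j + α)) = (n : ℝ) ^ (1 - α) * ((n : ℝ) ^ (-α)) ^ j := by
      rw [← Real.rpow_natCast, ← Real.rpow_mul hn'.le, ← Real.rpow_add hn']
      congr 1
      ring
    rw [this, neg_mul_eq_neg_mul, mul_pow]
    ring
  refine Tendsto.congr' hterm ?_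
  refine tendsto_tsum_of_dominated_convergence
    (summable_add_two_pow_mul_geometric (M + 1) (by positivity) hM1) (fun j => ?_) ?_
  · simpa [div_eq_mul_inv] using (tendsto_rpow_mul_multichoose (hβ j)).const_mul ((-x) ^ j)
  · filter_upwards [eventually_ge_atTop M] with n hn j
    have h1 := rpow_mul_multichoose_le (hβ j) hM0 hn
    have h2 := multichoose_nonneg (hβ j).le n
    have h3 : (M : ℝ) ^ (-(α * j + α)) ≤ ((M : ℝ) ^ (-α)) ^ j := by
      rw [← Real.rpow_natCast, ← Real.rpow_mul hM0'.le]
      refine Real.rpow_le_rpow_of_exponent_le (by exact_mod_cast hM0) ?_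
      linarith
    have h4 : 1 + (α * j + α) ≤ (j : ℝ) + 2 := by nlinarith [j.cast_nonneg (α := ℝ)]
    have h5 := hβ j
    rw [norm_mul, norm_pow, norm_neg, Real.norm_of_nonneg hx, Real.norm_of_nonneg (by positivity),
      mul_pow]
    calc x ^ j * ((n : ℝ) ^ (1 - (α * j + α)) * Ring.multichoose (α * j + α) n)
        ≤ x ^ j * (((j : ℝ) + 2) ^ (M + 1) * ((M : ℝ) ^ (-α)) ^ j) := by
          refine mul_le_mul_of_nonneg_left (h1.trans ?_) (by positivity)
          gcongr
      _ = _ := by ring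

theorem mittagLeffler_neg_nonneg {α x : ℝ} (hα0 : 0 < α) (hα1 : α ≤ 1) (hx : 0 ≤ x) :
    0 ≤ mittagLeffler α α (-x) := by
  have hlim : Tendsto (fun n : ℕ => x * (n : ℝ) ^ (-α)) atTop (𝓝 0) := by
    simpa using ((tendsto_rpow_neg_atTop hα0).comp tendsto_natCast_atTop_atTop).const_mul x
  refine ge_of_tendsto (tendsto_rpow_mul_resolventCoeff hα0 hα1 hx) ?_
  filter_upwards [hlim.eventually_lt_const one_pos] with n hn
  have := resolventCoeff_nonneg hα0.le hα1 (by positivity : 0 ≤ x * (n : ℝ) ^ (-α)) hn n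
  positivity

theorem mittagLeffler_neg_antitoneOn {α : ℝ} (hα0 : 0 < α) (hα1 : α ≤ 1) :
    AntitoneOn (fun x => mittagLeffler α α (-x)) (Set.Ici 0) := by
  intro x hx y hy hxy
  rw [Set.mem_Ici] at hx hy
  have hlim : Tendsto (fun n : ℕ => y * (n : ℝ) ^ (-α)) atTop (𝓝 0) := by
    simpa using ((tendsto_rpow_neg_atTop hα0).comp tendsto_natCast_atTop_atTop).const_mul y
  refine le_of_tendsto_of_tendsto (tendsto_rpow_mul_resolventCoeff hα0 hα1 hy)
    (tendsto_rpow_mul_resolventCoeff hα0 hα1 hx) ?_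
  filter_upwards [hlim.eventually_lt_const one_pos] with n hn
  refine mul_le_mul_of_nonneg_left ?_ (by positivity)
  exact resolventCoeff_anti hα0.le hα1 (by positivity) (by gcongr) hn n

theorem mittagLeffler_zero (α β : ℝ) : mittagLeffler α β 0 = (Real.Gamma β)⁻¹ := by
  rw [mittagLeffler, tsum_eq_single 0 fun n hn => by simp [hn]]
  simp

theorem mittagLeffler_neg_le {α x : ℝ} (hα0 : 0 < α) (hα1 : α ≤ 1) (hx : 0 ≤ x) :
    mittagLeffler α α (-x) ≤ (Real.Gamma α)⁻¹ := by
  have h := mittagLeffler_neg_antitoneOn hα0 hα1 Set.self_mem_Ici (Set.mem_Ici.2 hx) hx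
  simpa [mittagLeffler_zero] using h

/-- The convolution kernel of `voigtOp`, without the factor `1 / η ^ α`. -/
noncomputable def voigtKernel (α τ u : ℝ) : ℝ :=
  u ^ (α - 1) * mittagLeffler α α (-((u / τ) ^ α))

section voigtKernel

variable {α τ : ℝ}

theorem voigtKernel_nonneg (hα0 : 0 < α) (hα1 : α ≤ 1) (hτ : 0 < τ) {u : ℝ} (hu : 0 ≤ u) :
    0 ≤ voigtKernel α τ u :=
  mul_nonneg (by positivity) (mittagLeffler_neg_nonneg hα0 hα1 (by positivity))

theorem voigtKernel_le (hα0 : 0 < α) (hα1 : α ≤ 1) (hτ : 0 < τ) {u : ℝ} (hu : 0 ≤ u) :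
    voigtKernel α τ u ≤ u ^ (α - 1) * (Real.Gamma α)⁻¹ :=
  mul_le_mul_of_nonneg_left (mittagLeffler_neg_le hα0 hα1 (by positivity)) (by positivity)

theorem voigtKernel_antitoneOn (hα0 : 0 < α) (hα1 : α ≤ 1) (hτ : 0 < τ) :
    AntitoneOn (voigtKernel α τ) (Set.Ioi 0) := by
  intro u hu v hv huv
  rw [Set.mem_Ioi] at hu hv
  refine mul_le_mul (Real.rpow_le_rpow_of_nonpos hu huv (by linarith))
    (mittagLeffler_neg_antitoneOn hα0 hα1 ?_ ?_ ?_)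
    (mittagLeffler_neg_nonneg hα0 hα1 (by positivity)) (by positivity)
  · exact Set.mem_Ici.2 (by positivity)
  · exact Set.mem_Ici.2 (by positivity)
  · gcongr

theorem intervalIntegrable_voigtKernel_zero (hα0 : 0 < α) (hα1 : α ≤ 1) (hτ : 0 < τ) {b : ℝ}
    (hb : 0 ≤ b) : IntervalIntegrable (voigtKernel α τ) volume 0 b := by
  refine IntervalIntegrable.mono_fun'
    ((intervalIntegrable_rpow' (by linarith : -1 < α - 1)).mul_const (Real.Gamma α)⁻¹) ?_ ?_
  · rw [Set.uIoc_of_le hb]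
    exact (aemeasurable_restrict_of_antitoneOn measurableSet_Ioc
      ((voigtKernel_antitoneOn hα0 hα1 hτ).mono fun _ h => h.1)).aestronglyMeasurable
  · rw [Set.uIoc_of_le hb]
    filter_upwards [ae_restrict_mem measurableSet_Ioc] with u hu
    rw [Real.norm_of_nonneg (voigtKernel_nonneg hα0 hα1 hτ hu.1.le)]
    exact voigtKernel_le hα0 hα1 hτ hu.1.le

theorem intervalIntegrable_voigtKernel (hα0 : 0 < α) (hα1 : α ≤ 1) (hτ : 0 < τ) {a b : ℝ}
    (ha : 0 ≤ a) (hb : 0 ≤ b) : IntervalIntegrable (voigtKernel α τ) volume a b :=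
  (intervalIntegrable_voigtKernel_zero hα0 hα1 hτ ha).symm.trans
    (intervalIntegrable_voigtKernel_zero hα0 hα1 hτ hb)

theorem intervalIntegrable_voigtKernel_sub (hα0 : 0 < α) (hα1 : α ≤ 1) (hτ : 0 < τ) {a b t : ℝ}
    (ha : a ≤ t) (hb : b ≤ t) :
    IntervalIntegrable (fun s => voigtKernel α τ (t - s)) volume a b := by
  simpa using (intervalIntegrable_voigtKernel hα0 hα1 hτ (sub_nonneg.2 ha)
    (sub_nonneg.2 hb)).comp_sub_left t

theorem integral_voigtKernel_le (hα0 : 0 < α) (hα1 : α ≤ 1) (hτ : 0 < τ) {b : ℝ} (hb : 0 ≤ b) :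
    ∫ u in (0 : ℝ)..b, voigtKernel α τ u ≤ b ^ α / Real.Gamma (α + 1) := by
  have hα : -1 < α - 1 := by linarith
  calc ∫ u in (0 : ℝ)..b, voigtKernel α τ u
      ≤ ∫ u in (0 : ℝ)..b, u ^ (α - 1) * (Real.Gamma α)⁻¹ :=
        integral_mono_on hb (intervalIntegrable_voigtKernel_zero hα0 hα1 hτ hb)
          ((intervalIntegrable_rpow' hα).mul_const _)
          fun u hu => voigtKernel_le hα0 hα1 hτ hu.1
    _ = _ := by
        rw [intervalIntegral.integral_mul_const, integral_rpow (Or.inl hα), sub_add_cancel,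
          Real.zero_rpow hα0.ne', Real.Gamma_add_one hα0.ne', sub_zero]
        field_simp

end voigtKernel

/-- An increment estimate for the convolution of the kernel with a function valued in `[0, ρ]`. -/
theorem abs_integral_voigtKernel_sub_le {α τ : ℝ} (hα0 : 0 < α) (hα1 : α ≤ 1) (hτ : 0 < τ)
    {f : ℝ → ℝ} {ρ t₁ t₂ : ℝ} (h1 : 0 ≤ t₁) (h12 : t₁ ≤ t₂) (hfc : ContinuousOn f (Set.Icc 0 t₂))
    (hf0 : ∀ s ∈ Set.Icc 0 t₂, 0 ≤ f s) (hfρ : ∀ s ∈ Set.Icc 0 t₂, f s ≤ ρ) :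
    |(∫ s in (0 : ℝ)..t₂, voigtKernel α τ (t₂ - s) * f s) -
      ∫ s in (0 : ℝ)..t₁, voigtKernel α τ (t₁ - s) * f s| ≤
      ρ * ∫ u in (0 : ℝ)..(t₂ - t₁), voigtKernel α τ u := by
  set k := voigtKernel α τ with hk
  have h2 := h1.trans h12
  have hρ : 0 ≤ ρ := (hf0 0 ⟨le_rfl, h2⟩).trans (hfρ 0 ⟨le_rfl, h2⟩)
  have hfc1 : ContinuousOn f (Set.uIcc 0 t₁) :=
    hfc.mono (by rw [Set.uIcc_of_le h1]; exact Set.Icc_subset_Icc le_rfl h12)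
  have hfc2 : ContinuousOn f (Set.uIcc t₁ t₂) :=
    hfc.mono (by rw [Set.uIcc_of_le h12]; exact Set.Icc_subset_Icc h1 le_rfl)
  have i1 := intervalIntegrable_voigtKernel_sub hα0 hα1 hτ h1 (le_refl t₁)
  have i2 := intervalIntegrable_voigtKernel_sub hα0 hα1 hτ h2 h12
  have i3 := intervalIntegrable_voigtKernel_sub hα0 hα1 hτ h12 (le_refl t₂)
  rw [← hk] at i1 i2 i3
  have j1 := i1.mul_continuousOn hfc1
  have j2 := i2.mul_continuousOn hfc1
  have j3 := i3.mul_continuousOn hfc2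
  have hnew : ∫ s in t₁..t₂, k (t₂ - s) = ∫ u in (0 : ℝ)..(t₂ - t₁), k u := by
    rw [integral_comp_sub_left, sub_self]
  have hnew_nonneg : 0 ≤ ∫ s in t₁..t₂, k (t₂ - s) * f s :=
    integral_nonneg h12 fun s hs => mul_nonneg
      (voigtKernel_nonneg hα0 hα1 hτ (sub_nonneg.2 hs.2)) (hf0 s ⟨h1.trans hs.1, hs.2⟩)
  have hnew_le : ∫ s in t₁..t₂, k (t₂ - s) * f s ≤ ρ * ∫ u in (0 : ℝ)..(t₂ - t₁), k u := by
    rw [← hnew, mul_comm, ← intervalIntegral.integral_mul_const]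
    exact integral_mono_on h12 j3 (i3.mul_const ρ) fun s hs => mul_le_mul_of_nonneg_left
      (hfρ s ⟨h1.trans hs.1, hs.2⟩) (voigtKernel_nonneg hα0 hα1 hτ (sub_nonneg.2 hs.2))
  have hmono : ∀ s ∈ Set.Ioo 0 t₁, k (t₂ - s) ≤ k (t₁ - s) := fun s hs =>
    voigtKernel_antitoneOn hα0 hα1 hτ (sub_pos.2 hs.2) (sub_pos.2 (hs.2.trans_le h12))
      (by linarith)
  have hold_le : ∫ s in (0 : ℝ)..t₁, k (t₂ - s) * f s ≤ ∫ s in (0 : ℝ)..t₁, k (t₁ - s) * f s :=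
    integral_mono_on_of_le_Ioo h1 j2 j1 fun s hs => mul_le_mul_of_nonneg_right (hmono s hs)
      (hf0 s ⟨hs.1.le, hs.2.le.trans h12⟩)
  have hold_ge : (∫ s in (0 : ℝ)..t₁, k (t₁ - s) * f s) - ∫ s in (0 : ℝ)..t₁, k (t₂ - s) * f s ≤
      ρ * ((∫ s in (0 : ℝ)..t₁, k (t₁ - s)) - ∫ s in (0 : ℝ)..t₁, k (t₂ - s)) := by
    rw [← integral_sub j1 j2, ← integral_sub i1 i2, ← intervalIntegral.integral_const_mul]
    refine integral_mono_on_of_le_Ioo h1 (j1.sub j2) ((i1.sub i2).const_mul ρ) fun s hs => ?_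
    nlinarith [hmono s hs, hfρ s ⟨hs.1.le, hs.2.le.trans h12⟩]
  have hold : (∫ s in (0 : ℝ)..t₁, k (t₁ - s)) - ∫ s in (0 : ℝ)..t₁, k (t₂ - s) ≤
      ∫ u in (0 : ℝ)..(t₂ - t₁), k u := by
    have e1 := integral_add_adjacent_intervals i2 i3
    have e2 : ∫ s in (0 : ℝ)..t₂, k (t₂ - s) = ∫ u in (0 : ℝ)..t₂, k u := by simp
    have e3 : ∫ s in (0 : ℝ)..t₁, k (t₁ - s) = ∫ u in (0 : ℝ)..t₁, k u := by simp
    have e4 : ∫ u in (0 : ℝ)..t₁, k u ≤ ∫ u in (0 : ℝ)..t₂, k u := by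
      rw [← integral_add_adjacent_intervals
        (intervalIntegrable_voigtKernel hα0 hα1 hτ le_rfl h1)
        (intervalIntegrable_voigtKernel hα0 hα1 hτ h1 h2)]
      exact le_add_of_nonneg_right (integral_nonneg h12 fun u hu =>
        voigtKernel_nonneg hα0 hα1 hτ (h1.trans hu.1))
    linarith
  have hold' := mul_le_mul_of_nonneg_left hold hρ
  rw [← integral_add_adjacent_intervals j2 j3, abs_le]
  constructor <;> linarith

/-- Equicontinuity estimate for `T`: if `0 ≤ ε ≤ η₀` on `[0,1]` and `ρ ≥ σ(u)` for
`u ∈ [0,η₀]`, then `|(Tε)(t₂) − (Tε)(t₁)| ≤ 2ρ (t₂−t₁)^α/(η^α Γ(α+1))` for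
`t₁ ≤ t₂` in `[0,1]`. -/
theorem voigtOp_equicontinuous
    (α η τ : ℝ) (hα : α ∈ Set.Ioc (0:ℝ) 1) (hη : 0 < η) (hτ : 0 < τ)
    (σ : ℝ → ℝ) (hσc : ContinuousOn σ (Set.Ici 0)) (hσ0 : ∀ u ∈ Set.Ici (0:ℝ), 0 ≤ σ u)
    (η₀ : ℝ) (hη₀ : 0 < η₀)
    (ε : ℝ → ℝ) (hεc : ContinuousOn ε (Set.Icc 0 1))
    (hεb : ∀ t ∈ Set.Icc (0:ℝ) 1, ε t ∈ Set.Icc 0 η₀)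
    (ρ : ℝ) (hρ : ∀ u ∈ Set.Icc (0:ℝ) η₀, σ u ≤ ρ) :
    ∀ t₁ ∈ Set.Icc (0:ℝ) 1, ∀ t₂ ∈ Set.Icc (0:ℝ) 1, t₁ ≤ t₂ →
      |voigtOp α η τ σ ε t₂ - voigtOp α η τ σ ε t₁| ≤
        2 * ρ * (t₂ - t₁) ^ α / (η ^ α * Real.Gamma (α + 1)) := by
  intro t₁ h1 t₂ h2 h12
  obtain ⟨hα0, hα1⟩ := hα
  have hsub : Set.Icc 0 t₂ ⊆ Set.Icc 0 1 := Set.Icc_subset_Icc le_rfl h2.2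
  have hρ0 : 0 ≤ ρ := (hσ0 0 Set.self_mem_Ici).trans (hρ 0 ⟨le_rfl, hη₀.le⟩)
  have hinc := abs_integral_voigtKernel_sub_le hα0 hα1 hτ (f := fun s => σ (ε s)) h1.1 h12
    ((hσc.comp hεc fun t ht => (hεb t ht).1).mono hsub)
    (fun s hs => hσ0 _ (hεb s (hsub hs)).1) (fun s hs => hρ _ (hεb s (hsub hs)))
  have hle := integral_voigtKernel_le hα0 hα1 hτ (sub_nonneg.2 h12)
  have hΓ : 0 < Real.Gamma (α + 1) := Real.Gamma_pos_of_pos (by positivity)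
  have hηα : 0 < η ^ α := by positivity
  have hδ : 0 ≤ (t₂ - t₁) ^ α := Real.rpow_nonneg (sub_nonneg.2 h12) α
  change |1 / η ^ α * (∫ s in (0 : ℝ)..t₂, voigtKernel α τ (t₂ - s) * σ (ε s)) -
    1 / η ^ α * ∫ s in (0 : ℝ)..t₁, voigtKernel α τ (t₁ - s) * σ (ε s)| ≤ _
  rw [← mul_sub, abs_mul, abs_of_pos (by positivity : 0 < 1 / η ^ α)]
  calc 1 / η ^ α * _ ≤ 1 / η ^ α * (ρ * ((t₂ - t₁) ^ α / Real.Gamma (α + 1))) := by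
        refine mul_le_mul_of_nonneg_left (hinc.trans ?_) (by positivity)
        gcongr
    _ ≤ 2 * (1 / η ^ α * (ρ * ((t₂ - t₁) ^ α / Real.Gamma (α + 1)))) :=
        le_mul_of_one_le_left (by positivity) one_le_two
    _ = _ := by field_simp
end

section
/- Consider σ(u) = 1/(1+u) on [0,∞), and take α = 1/2, η = 1, E = 2 (so that η^α = 1, E^α = √2 and τ = η/E = 1/2). Then there exists a continuous function ε: [0,1] → ℝ with ε(t) ≥ 0 for all t ∈ [0,1], ε not identically zero, such that ε(t) = ∫₀ᵗ (t−s)^{−1/2} E_{1/2,1/2}(−√2 (t−s)^{1/2}) · 1/(1 + ε(s)) ds for every t ∈ [0,1]. That is, the fractional initial value problem ^C D₀^{1/2} ε(t) + √2 ε(t) = 1/(1+ε(t)) on (0,1], ε(0) = 0, has at least one nontrivial bounded positive solution. -/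
section

open MeasureTheory Set

/-- The Laplace-type integral `∫₀^∞ 2u exp(-u²) exp(-2zu) du`, which equals
`√π E_{1/2,1/2}(-z)`. -/
noncomputable def laplaceGauss (z : ℝ) : ℝ :=
  ∫ u in Ioi (0 : ℝ), 2 * u * Real.exp (-u ^ 2) * Real.exp (-(2 * z * u))

lemma integrableOn_laplaceGauss (z : ℝ) :
    IntegrableOn (fun u : ℝ => 2 * u * Real.exp (-u ^ 2) * Real.exp (-(2 * z * u))) (Ioi 0) := by
  have h : Integrable (fun u : ℝ => 2 * Real.exp (2 * z ^ 2) * (u * Real.exp (-(1 / 2) * u ^ 2))) :=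
    (integrable_mul_exp_neg_mul_sq (by norm_num)).const_mul _
  refine h.integrableOn.mono' (by fun_prop) ?_
  refine (ae_restrict_iff' measurableSet_Ioi).2 (ae_of_all _ fun u (hu : 0 < u) => ?_)
  rw [Real.norm_of_nonneg (by positivity)]
  have key : Real.exp (-u ^ 2) * Real.exp (-(2 * z * u)) ≤
      Real.exp (2 * z ^ 2) * Real.exp (-(1 / 2) * u ^ 2) := by
    rw [← Real.exp_add, ← Real.exp_add]
    exact Real.exp_le_exp.2 (by nlinarith [sq_nonneg (u + 2 * z)])
  calc _ = 2 * u * (Real.exp (-u ^ 2) * Real.exp (-(2 * z * u))) := by ring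
    _ ≤ 2 * u * (Real.exp (2 * z ^ 2) * Real.exp (-(1 / 2) * u ^ 2)) := by gcongr
    _ = _ := by ring

lemma laplaceGauss_pos (z : ℝ) : 0 < laplaceGauss z := by
  have hpos : ∀ u ∈ Ioi (0 : ℝ), 0 < 2 * u * Real.exp (-u ^ 2) * Real.exp (-(2 * z * u)) :=
    fun u (hu : 0 < u) => by positivity
  refine (setIntegral_pos_iff_support_of_nonneg_ae ?_ (integrableOn_laplaceGauss z)).2 ?_
  · exact (ae_restrict_iff' measurableSet_Ioi).2 (ae_of_all _ fun u hu => (hpos u hu).le)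
  · have hsub : Ioi (0 : ℝ) ⊆
        Function.support fun u : ℝ => 2 * u * Real.exp (-u ^ 2) * Real.exp (-(2 * z * u)) :=
      fun u hu => (hpos u hu).ne'
    rw [inter_eq_right.2 hsub]
    simp

lemma continuous_laplaceGauss_abs : Continuous fun z : ℝ => laplaceGauss |z| := by
  refine continuous_of_dominated
    (bound := fun u => 2 * u * Real.exp (-u ^ 2) * Real.exp (-(2 * 0 * u)))
    (fun z => by fun_prop) (fun z => ?_) (integrableOn_laplaceGauss 0)
    (ae_of_all _ fun u => by fun_prop)
  refine (ae_restrict_iff' measurableSet_Ioi).2 (ae_of_all _ fun u (hu : 0 < u) => ?_)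
  rw [Real.norm_of_nonneg (by positivity)]
  gcongr
  exact abs_nonneg z

lemma integral_pow_succ_mul_exp_neg_sq (n : ℕ) :
    ∫ u in Ioi (0 : ℝ), u ^ (n + 1) * Real.exp (-u ^ 2) =
      1 / 2 * Real.Gamma ((n + 1) / 2 + 1 / 2) := by
  have h := integral_rpow_mul_exp_neg_rpow (p := 2) (q := n + 1) (by norm_num)
    (by linarith [n.cast_nonneg (α := ℝ)])
  rw [show ((n : ℝ) + 1) / 2 + 1 / 2 = (n + 1 + 1) / 2 by ring, ← h]
  congr 1
  ext u
  norm_cast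

lemma laplaceGauss_zero : laplaceGauss 0 = 1 := by
  have h := integral_pow_succ_mul_exp_neg_sq 0
  norm_num at h
  simp only [laplaceGauss, mul_zero, zero_mul, neg_zero, Real.exp_zero, mul_one, mul_assoc]
  rw [integral_const_mul, h]
  norm_num

lemma laplaceGauss_sqrt_two_le : laplaceGauss √2 ≤ 1 / 4 := by
  have hs : (0 : ℝ) < √2 := by positivity
  have hval := Real.integral_rpow_mul_exp_neg_mul_Ioi (a := 2) (r := 2 * √2) (by norm_num)
    (by positivity)
  have hval : ∫ u in Ioi (0 : ℝ), u * Real.exp (-(2 * √2 * u)) = 1 / 8 := by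
    norm_num [Real.Gamma_two, mul_pow] at hval
    rw [hval]
  have hint : IntegrableOn (fun u : ℝ => u * Real.exp (-(2 * √2 * u))) (Ioi 0) :=
    not_imp_comm.1 integral_undef (by rw [hval]; norm_num)
  have : laplaceGauss √2 ≤ ∫ u in Ioi (0 : ℝ), 2 * (u * Real.exp (-(2 * √2 * u))) := by
    refine setIntegral_mono_on (integrableOn_laplaceGauss _) (hint.const_mul 2)
      measurableSet_Ioi fun u (hu : 0 < u) => ?_
    have h1 : Real.exp (-u ^ 2) ≤ 1 := Real.exp_le_one_iff.2 (by nlinarith)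
    calc _ ≤ 2 * u * 1 * Real.exp (-(2 * √2 * u)) := by gcongr
      _ = _ := by ring
  rw [integral_const_mul, hval] at this
  linarith

lemma laplaceGauss_sqrt_two_mul_le {y : ℝ} (h0 : 0 ≤ y) (h1 : y ≤ 1) :
    laplaceGauss (√2 * y) ≤ 1 - 3 / 4 * y := by
  have : laplaceGauss (√2 * y) ≤ (1 - y) * laplaceGauss 0 + y * laplaceGauss √2 := by
    unfold laplaceGauss
    have i0 := integrableOn_laplaceGauss 0
    have i1 := integrableOn_laplaceGauss √2
    rw [← integral_const_mul, ← integral_const_mul,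
      ← integral_add (i0.const_mul _) (i1.const_mul _)]
    refine setIntegral_mono_on (integrableOn_laplaceGauss _)
      ((i0.const_mul _).add (i1.const_mul _)) measurableSet_Ioi fun u (hu : 0 < u) => ?_
    have hc := convexOn_exp.2 (mem_univ (-(2 * 0 * u))) (mem_univ (-(2 * √2 * u)))
      (sub_nonneg.2 h1) h0 (by ring)
    simp only [smul_eq_mul] at hc
    rw [show (1 - y) * -(2 * 0 * u) + y * -(2 * √2 * u) = -(2 * (√2 * y) * u) by ring] at hc
    calc _ ≤ 2 * u * Real.exp (-u ^ 2) *
          ((1 - y) * Real.exp (-(2 * 0 * u)) + y * Real.exp (-(2 * √2 * u))) := by gcongr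
      _ = _ := by ring
  rw [laplaceGauss_zero] at this
  nlinarith [laplaceGauss_sqrt_two_le]

/-- Termwise evaluation of the expansion of `laplaceGauss` by the duplication formula. -/
lemma integral_laplaceGauss_term (z : ℝ) (n : ℕ) :
    ∫ u in Ioi (0 : ℝ), 2 * u * Real.exp (-u ^ 2) * ((-(2 * z * u)) ^ n / n.factorial) =
      √Real.pi * ((-z) ^ n / Real.Gamma (1 / 2 * n + 1 / 2)) := by
  have hdup := Real.Gamma_mul_Gamma_add_half ((n + 1) / 2)
  rw [show 2 * (((n : ℝ) + 1) / 2) = n + 1 by ring, Real.Gamma_nat_eq_factorial,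
    show (1 : ℝ) - (n + 1) = -n by ring, Real.rpow_neg (by norm_num), Real.rpow_natCast] at hdup
  have hG : Real.Gamma (((n : ℝ) + 1) / 2) ≠ 0 := (Real.Gamma_pos_of_pos (by positivity)).ne'
  have hf : (n.factorial : ℝ) ≠ 0 := by positivity
  calc _ = ∫ u in Ioi (0 : ℝ),
        2 * (-(2 * z)) ^ n / n.factorial * (u ^ (n + 1) * Real.exp (-u ^ 2)) := by
        congr 1
        ext u
        rw [show -(2 * z * u) = -(2 * z) * u by ring, mul_pow, pow_succ]
        ring
    _ = _ := by
        rw [integral_const_mul, integral_pow_succ_mul_exp_neg_sq,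
          show (1 : ℝ) / 2 * n + 1 / 2 = (n + 1) / 2 by ring,
          show -(2 * z) = 2 * -z by ring, mul_pow]
        field_simp
        field_simp at hdup
        linear_combination (-z) ^ n * hdup

lemma hasSum_laplaceGauss (z : ℝ) :
    HasSum (fun n : ℕ => √Real.pi * ((-z) ^ n / Real.Gamma (1 / 2 * n + 1 / 2)))
      (laplaceGauss z) := by
  have hexp : ∀ c u : ℝ, HasSum
      (fun n : ℕ => 2 * u * Real.exp (-u ^ 2) * ((-(2 * c * u)) ^ n / n.factorial))
      (2 * u * Real.exp (-u ^ 2) * Real.exp (-(2 * c * u))) := fun c u => by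
    have h := NormedSpace.expSeries_div_hasSum_exp (𝔸 := ℝ) (-(2 * c * u))
    rw [← Real.exp_eq_exp_ℝ] at h
    exact h.mul_left (2 * u * Real.exp (-u ^ 2))
  simp only [← integral_laplaceGauss_term]
  refine hasSum_integral_of_dominated_convergence
    (fun n u => 2 * u * Real.exp (-u ^ 2) * ((-(2 * -|z| * u)) ^ n / n.factorial))
    (fun n => ?_) (fun n => ?_) (ae_of_all _ fun u => (hexp _ u).summable)
    ?_ (ae_of_all _ fun u => hexp z u)
  · exact Continuous.aestronglyMeasurable (by fun_prop)
  · refine (ae_restrict_iff' measurableSet_Ioi).2 (ae_of_all _ fun u (hu : 0 < u) => ?_)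
    simp [abs_of_pos hu, mul_assoc]
  · simp only [(hexp _ _).tsum_eq]
    exact integrableOn_laplaceGauss _

lemma mittagLeffler_half_half_neg (z : ℝ) :
    mittagLeffler (1 / 2) (1 / 2) (-z) = laplaceGauss z / √Real.pi := by
  have hpi : √Real.pi ≠ 0 := by positivity
  rw [eq_div_iff hpi, mul_comm, mittagLeffler, ← tsum_mul_left, (hasSum_laplaceGauss z).tsum_eq]

/-- Substituting `s = t (1 - y²)` removes the singularity of the Volterra kernel. -/
lemma integral_kernel_mul_eq {t : ℝ} (ht : 0 ≤ t) (h : ℝ → ℝ) :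
    ∫ s in (0:ℝ)..t, (t - s) ^ (-(1/2) : ℝ) *
        mittagLeffler (1/2) (1/2) (-(√2 * (t - s) ^ ((1:ℝ)/2))) * h s =
      ∫ y in (0:ℝ)..1, 2 / √Real.pi * √t * laplaceGauss |√2 * (√t * y)| * h (t * (1 - y ^ 2)) := by
  rcases ht.eq_or_lt with rfl | ht
  · simp
  have himage : (fun y : ℝ => t * (1 - y ^ 2)) '' Ioo 0 1 = Ioo 0 t := by
    ext s
    constructor
    · rintro ⟨y, ⟨h0, h1⟩, rfl⟩
      exact ⟨mul_pos ht (by nlinarith), by nlinarith [mul_pos ht (mul_pos h0 h0)]⟩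
    · rintro ⟨h0, h1⟩
      have hd : 0 < 1 - s / t := sub_pos.2 ((div_lt_one ht).2 h1)
      refine ⟨√(1 - s / t), ⟨Real.sqrt_pos.2 hd, ?_⟩, ?_⟩
      · rw [Real.sqrt_lt' one_pos]
        have : 0 < s / t := by positivity
        linarith
      · simp only [Real.sq_sqrt hd.le]
        field_simp
        ring
  have hinj : InjOn (fun y : ℝ => t * (1 - y ^ 2)) (Ioo 0 1) := by
    intro x hx y hy hxy
    have : x ^ 2 = y ^ 2 := by linarith [mul_left_cancel₀ ht.ne' hxy]
    exact (pow_left_inj₀ hx.1.le hy.1.le two_ne_zero).1 this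
  have hderiv : ∀ y ∈ Ioo (0 : ℝ) 1,
      HasDerivWithinAt (fun y : ℝ => t * (1 - y ^ 2)) (-(2 * t * y)) (Ioo 0 1) y := by
    intro y _
    have h := (((hasDerivAt_pow 2 y).const_sub 1).const_mul t).hasDerivWithinAt (s := Ioo 0 1)
    rwa [show t * -(((2 : ℕ) : ℝ) * y ^ (2 - 1)) = -(2 * t * y) by norm_num; ring] at h
  rw [intervalIntegral.integral_of_le ht.le, intervalIntegral.integral_of_le zero_le_one,
    integral_Ioc_eq_integral_Ioo, integral_Ioc_eq_integral_Ioo, ← himage,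
    integral_image_eq_integral_abs_deriv_smul measurableSet_Ioo hderiv hinj]
  refine setIntegral_congr_fun measurableSet_Ioo fun y ⟨hy, _⟩ => ?_
  have hroot : t - t * (1 - y ^ 2) = (√t * y) ^ 2 := by
    rw [mul_pow, Real.sq_sqrt ht.le]
    ring
  have hsq : 0 < √t := Real.sqrt_pos.2 ht
  have hpos : 0 < √t * y := by positivity
  have hhalf : ((√t * y) ^ 2) ^ ((1 : ℝ) / 2) = √t * y := by
    rw [← Real.sqrt_eq_rpow, Real.sqrt_sq hpos.le]
  simp only [smul_eq_mul]
  rw [hroot, Real.rpow_neg (by positivity), hhalf, mittagLeffler_half_half_neg,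
    abs_neg, abs_of_pos (by positivity : 0 < 2 * t * y),
    abs_of_pos (by positivity : 0 < √2 * (√t * y))]
  have hpi : 0 < √Real.pi := by positivity
  field_simp
  rw [Real.sq_sqrt ht.le]

/-- The Volterra operator of the initial value problem, after the substitution of
`integral_kernel_mul_eq`; the absolute value extends the nonlinearity to all real values. -/
noncomputable def voigtOperator (f : C(Icc (0 : ℝ) 1, ℝ)) : C(Icc (0 : ℝ) 1, ℝ) where
  toFun t := ∫ y in (0:ℝ)..1, 2 / √Real.pi * √t * laplaceGauss |√2 * (√t * y)| *
    (1 / (1 + |IccExtend zero_le_one f (t * (1 - y ^ 2))|))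
  continuous_toFun := by
    refine intervalIntegral.continuous_parametric_intervalIntegral_of_continuous' ?_ 0 1
    have hf : Continuous (IccExtend zero_le_one f) := f.continuous.Icc_extend'
    have hL : Continuous fun p : Icc (0 : ℝ) 1 × ℝ => laplaceGauss |√2 * (√p.1 * p.2)| :=
      continuous_laplaceGauss_abs.comp (by fun_prop)
    have hd : Continuous fun p : Icc (0 : ℝ) 1 × ℝ =>
        1 / (1 + |IccExtend zero_le_one f (p.1 * (1 - p.2 ^ 2))|) :=
      continuous_const.div (continuous_const.add (hf.comp (by fun_prop)).abs)
        fun p => by positivity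
    exact ((by fun_prop : Continuous fun p : Icc (0 : ℝ) 1 × ℝ => 2 / √Real.pi * √p.1).mul hL).mul hd

lemma voigtOperator_nonneg (f : C(Icc (0 : ℝ) 1, ℝ)) (t : Icc (0 : ℝ) 1) :
    0 ≤ voigtOperator f t := by
  refine intervalIntegral.integral_nonneg zero_le_one fun y _ => ?_
  have := laplaceGauss_pos |√2 * (√t * y)|
  positivity

lemma continuous_voigtOperator_integrand (f : C(Icc (0 : ℝ) 1, ℝ)) (t : ℝ) :
    Continuous fun y : ℝ => 2 / √Real.pi * √t * laplaceGauss |√2 * (√t * y)| *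
      (1 / (1 + |IccExtend zero_le_one f (t * (1 - y ^ 2))|)) := by
  have hf : Continuous (IccExtend zero_le_one f) := f.continuous.Icc_extend'
  refine (continuous_const.mul (continuous_laplaceGauss_abs.comp (by fun_prop))).mul ?_
  exact continuous_const.div (continuous_const.add (hf.comp (by fun_prop)).abs)
    fun y => by positivity

lemma voigtOperator_one_pos (f : C(Icc (0 : ℝ) 1, ℝ)) :
    0 < voigtOperator f ⟨1, by simp⟩ := by
  refine intervalIntegral.intervalIntegral_pos_of_pos_on
    ((continuous_voigtOperator_integrand f 1).intervalIntegrable _ _) (fun y _ => ?_) zero_lt_one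
  have := laplaceGauss_pos |√2 * (√1 * y)|
  positivity

lemma abs_one_div_one_add_abs_sub_le (a b : ℝ) :
    |1 / (1 + |a|) - 1 / (1 + |b|)| ≤ |a - b| := by
  have ha := abs_nonneg a
  have hb := abs_nonneg b
  rw [div_sub_div _ _ (by positivity) (by positivity), abs_div,
    abs_of_pos (by positivity : 0 < (1 + |a|) * (1 + |b|)), div_le_iff₀ (by positivity)]
  calc _ = |(|b| - |a|)| := by ring_nf
    _ ≤ |b - a| := abs_abs_sub_abs_le b a
    _ = |a - b| * 1 := by rw [abs_sub_comm, mul_one]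
    _ ≤ _ := by gcongr; nlinarith

lemma contractingWith_voigtOperator : ContractingWith (3 / 4) voigtOperator := by
  refine ⟨by rw [← NNReal.coe_lt_coe]; norm_num, LipschitzWith.of_dist_le_mul fun f g => ?_⟩
  rw [ContinuousMap.dist_le (by positivity)]
  intro t
  set w : ℝ := √t with hw
  have hw0 : 0 ≤ w := Real.sqrt_nonneg _
  have hw1 : w ≤ 1 := Real.sqrt_le_one.2 t.2.2
  rw [Real.dist_eq]
  simp only [voigtOperator, ContinuousMap.coe_mk]
  rw [← intervalIntegral.integral_sub
    ((continuous_voigtOperator_integrand f t).intervalIntegrable _ _)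
    ((continuous_voigtOperator_integrand g t).intervalIntegrable _ _), ← Real.norm_eq_abs]
  have hpi : 7 / 4 ≤ √Real.pi := Real.le_sqrt_of_sq_le (by linarith [Real.pi_gt_d2])
  have hpi2 : 2 / √Real.pi ≤ 8 / 7 := by
    rw [div_le_iff₀ (by positivity)]
    linarith
  have hbound := intervalIntegral.norm_integral_le_of_norm_le (μ := volume) (zero_le_one' ℝ)
    (f := fun y => 2 / √Real.pi * √t * laplaceGauss |√2 * (√t * y)| *
      (1 / (1 + |IccExtend zero_le_one f (t * (1 - y ^ 2))|)) -
      2 / √Real.pi * √t * laplaceGauss |√2 * (√t * y)| *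
      (1 / (1 + |IccExtend zero_le_one g (t * (1 - y ^ 2))|)))
    (g := fun y => 8 / 7 * w * (1 - 3 / 4 * (w * y)) * dist f g)
    (ae_of_all _ fun y ⟨hy0, hy1⟩ => ?_) ((by fun_prop : Continuous _).intervalIntegrable _ _)
  · refine hbound.trans ?_
    have hval : ∫ y in (0:ℝ)..1, 8 / 7 * w * (1 - 3 / 4 * (w * y)) * dist f g =
        8 / 7 * (w - 3 / 8 * w ^ 2) * dist f g := by
      rw [intervalIntegral.integral_mul_const, intervalIntegral.integral_const_mul,
        intervalIntegral.integral_sub (by simp) ((by fun_prop : Continuous _).intervalIntegrable _ _)]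
      rw [intervalIntegral.integral_const_mul, intervalIntegral.integral_const_mul, integral_id,
        intervalIntegral.integral_const, smul_eq_mul]
      ring
    rw [hval]
    gcongr
    norm_num
    nlinarith
  · have hwy1 : w * y ≤ 1 := mul_le_one₀ hw1 hy0.le hy1
    have hwy0 : 0 ≤ w * y := by positivity
    have hdist : |IccExtend zero_le_one f (t * (1 - y ^ 2)) -
        IccExtend zero_le_one g (t * (1 - y ^ 2))| ≤ dist f g :=
      ContinuousMap.dist_apply_le_dist (f := f) (g := g) (projIcc 0 1 zero_le_one _)
    have hL := laplaceGauss_sqrt_two_mul_le hwy0 hwy1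
    have hL0 := laplaceGauss_pos (√2 * (w * y))
    rw [← mul_sub, norm_mul, Real.norm_eq_abs (_ - _), ← hw,
      abs_of_nonneg (by positivity : 0 ≤ √2 * (w * y)), Real.norm_of_nonneg (by positivity)]
    have := (abs_one_div_one_add_abs_sub_le _ _).trans hdist
    have : 0 ≤ 1 - 3 / 4 * (w * y) := by linarith
    gcongr

end

/-- The fractional initial value problem `^C D₀^{1/2} ε + √2 ε = 1/(1+ε)`, `ε(0) = 0`,
has at least one nontrivial bounded positive solution, expressed in Volterra fixed
point form with kernel `(t−s)^{−1/2} E_{1/2,1/2}(−√2 (t−s)^{1/2})`. -/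
theorem example_fractional_voigt_existence :
    ∃ ε : ℝ → ℝ, ContinuousOn ε (Set.Icc 0 1) ∧
      (∀ t ∈ Set.Icc (0:ℝ) 1, 0 ≤ ε t) ∧
      (∃ t ∈ Set.Icc (0:ℝ) 1, ε t ≠ 0) ∧
      ∀ t ∈ Set.Icc (0:ℝ) 1, ε t =
        ∫ s in (0:ℝ)..t,
          (t - s) ^ (-(1/2) : ℝ) *
            mittagLeffler (1/2) (1/2) (-(Real.sqrt 2 * (t - s) ^ ((1:ℝ)/2))) *
              (1 / (1 + ε s)) := by
  have hc := contractingWith_voigtOperator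
  set f : C(Set.Icc (0 : ℝ) 1, ℝ) := ContractingWith.fixedPoint _ hc
  have hfix : voigtOperator f = f := hc.fixedPoint_isFixedPt
  have hval : ∀ t (ht : t ∈ Set.Icc (0 : ℝ) 1), Set.IccExtend zero_le_one f t = f ⟨t, ht⟩ :=
    fun t ht => Set.IccExtend_of_mem _ _ ht
  have hnonneg : ∀ t, 0 ≤ f t := fun t => hfix ▸ voigtOperator_nonneg f t
  have hpos : 0 < f ⟨1, by simp⟩ := hfix ▸ voigtOperator_one_pos f
  refine ⟨Set.IccExtend zero_le_one f, f.continuous.Icc_extend'.continuousOn,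
    fun t ht => hval t ht ▸ hnonneg _, ⟨1, by simp, by rw [hval 1 (by simp)]; exact hpos.ne'⟩,
    fun t ht => ?_⟩
  have habs : ∀ s, |Set.IccExtend zero_le_one f s| = Set.IccExtend zero_le_one f s :=
    fun s => abs_of_nonneg (hnonneg _)
  rw [integral_kernel_mul_eq ht.1 fun s => 1 / (1 + Set.IccExtend zero_le_one f s), hval t ht]
  conv_lhs => rw [← hfix]
  simp only [voigtOperator, ContinuousMap.coe_mk, habs]
end
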